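/- There exist constants δ > 0 and C > 0 with the following property. Let 𝔻 be the open unit disc in ℂ, let D ∈ ℝ and A ∈ (0, ∞), and let u : 𝔻 → ℝ be subharmonic on 𝔻 with u(z) ≤ D for all z ∈ 𝔻 and ∫_𝔻 e^{-u} dλ < A, where λ is Lebesgue measure on ℂ. Set ε = δ/(e^D · A). Then ∫_{𝔻(0,1/2)} e^{-(1+ε)u} dλ < C · (e^{-εD} · A + e^{-(1+ε)D}), where 𝔻(0,1/2) is the open disc of radius 1/2 centered at the origin. -/

import Mathlib

open MeasureTheory
open scoped ENNReal

/-! Here `ℂ` is identified with `ℝ²` and carries its standard Lebesgue measure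
(Mathlib's `volume` on `ℂ`). -/

/-- A function `u : Ω → ℝ` on an open set `Ω ⊆ ℂ` is subharmonic if it is upper
semicontinuous on `Ω` and satisfies the sub-mean value inequality over circles:
for all `a ∈ Ω` and `r > 0` such that the closed disc `{z : |z - a| ≤ r}` is contained
in `Ω`, one has `u a ≤ (2π)⁻¹ ∫₀^{2π} u (a + r e^{iθ}) dθ`. -/
def IsSubharmonicOn (Ω : Set ℂ) (u : ℂ → ℝ) : Prop :=
  UpperSemicontinuousOn u Ω ∧
  ∀ a ∈ Ω, ∀ r : ℝ, 0 < r →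
    (∀ z : ℂ, ‖z - a‖ ≤ r → z ∈ Ω) →
    u a ≤ (2 * Real.pi)⁻¹ *
      ∫ θ in (0 : ℝ)..(2 * Real.pi), u (a + (r : ℂ) * Complex.exp (θ * Complex.I))

section

open Real Set Metric

/-- Integrability in polar coordinates centred at `0`. -/
theorem integrableOn_polarCoord_symm {F : ℂ → ℝ} (hF : Integrable F) :
    IntegrableOn (fun p : ℝ × ℝ => p.1 * F (circleMap 0 p.1 p.2))
      (Ioi (0 : ℝ) ×ˢ Ioo (-π) π) := by
  have h1 : Integrable (fun p : ℝ × ℝ => F (Complex.measurableEquivRealProd.symm p)) :=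
    (Complex.volume_preserving_equiv_real_prod.symm).integrable_comp_of_integrable hF
  have h2 := (integrableOn_image_iff_integrableOn_abs_det_fderiv_smul volume
    (s := polarCoord.target) (polarCoord.open_target.measurableSet)
    (fun p _ => (hasFDerivAt_polarCoord_symm p).hasFDerivWithinAt)
    polarCoord.symm.injOn _).1 (h1.integrableOn)
  refine h2.congr_fun (fun p hp => ?_) polarCoord.open_target.measurableSet
  have hp0 : 0 < p.1 := hp.1
  simp only [det_fderivPolarCoordSymm, abs_of_pos hp0, smul_eq_mul,
    Complex.measurableEquivRealProd_symm_polarCoord_symm_apply, Complex.polarCoord_symm_apply,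
    circleMap, Complex.exp_mul_I, Complex.ofReal_cos, Complex.ofReal_sin, zero_add]

theorem integral_Ioo_circleMap (F : ℂ → ℝ) (c : ℂ) (r : ℝ) :
    ∫ θ in Ioo (-π) π, F (circleMap c r θ) = 2 * π * circleAverage F c r := by
  have h := ((periodic_circleMap c r).comp F).intervalIntegral_add_eq (-π) 0
  have e : -π + 2 * π = π := by ring
  rw [e, zero_add, intervalIntegral.integral_of_le (by linarith [pi_pos]),
    ← integral_Ioc_eq_integral_Ioo.symm] at h
  simp only [Function.comp_def] at h
  rw [h, circleAverage_def, smul_eq_mul, ← mul_assoc, mul_inv_cancel₀ (by positivity), one_mul]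

theorem circleIntegrable_of_integrableOn_Ioo {F : ℂ → ℝ} {c : ℂ} {r : ℝ}
    (h : IntegrableOn (fun θ => F (circleMap c r θ)) (Ioo (-π) π)) : CircleIntegrable F c r := by
  have hp := (periodic_circleMap c r).comp F
  rw [circleIntegrable_def]
  have h0 : IntervalIntegrable (fun θ => F (circleMap c r θ)) volume (-π) (-π + 2 * π) := by
    have e : -π + 2 * π = π := by ring
    rw [e, intervalIntegrable_iff_integrableOn_Ioo_of_le (by linarith [pi_pos])]
    exact h
  exact hp.intervalIntegrable (by positivity) h0 _ _

theorem ae_circleIntegrable {F : ℂ → ℝ} (hF : Integrable F) (c : ℂ) :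
    ∀ᵐ r ∂(volume.restrict (Ioi (0 : ℝ))), CircleIntegrable F c r := by
  have h := integrableOn_polarCoord_symm (hF.comp_add_left c)
  rw [IntegrableOn, Measure.volume_eq_prod, ← Measure.prod_restrict] at h
  filter_upwards [h.prod_right_ae, ae_restrict_mem measurableSet_Ioi] with r hr hr0
  apply circleIntegrable_of_integrableOn_Ioo
  have := hr.const_mul r⁻¹
  refine this.congr (Filter.Eventually.of_forall fun θ => ?_)
  have : (r : ℝ) ≠ 0 := ne_of_gt hr0
  simp [circleMap]
  field_simp

/-- Integration in polar coordinates, in terms of circle averages. -/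
theorem integral_eq_integral_circleAverage {F : ℂ → ℝ} (hF : Integrable F) (c : ℂ) :
    ∫ z, F z = ∫ r in Ioi (0 : ℝ), 2 * π * r * circleAverage F c r := by
  have h := integrableOn_polarCoord_symm (hF.comp_add_left c)
  rw [IntegrableOn, Measure.volume_eq_prod, ← Measure.prod_restrict] at h
  rw [← integral_add_left_eq_self F c, ← Complex.integral_comp_polarCoord_symm]
  have e : ∀ p : ℝ × ℝ, p.1 • F (c + Complex.polarCoord.symm p)
      = p.1 * F (c + circleMap 0 p.1 p.2) := by
    intro p
    simp only [smul_eq_mul, Complex.polarCoord_symm_apply, circleMap, Complex.exp_mul_I,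
      Complex.ofReal_cos, Complex.ofReal_sin, zero_add]
  simp_rw [e, polarCoord_target]
  rw [Measure.volume_eq_prod, ← Measure.prod_restrict, integral_prod _ h]
  refine integral_congr_ae (Filter.Eventually.of_forall fun r => ?_)
  simp only
  rw [integral_const_mul]
  have := integral_Ioo_circleMap F c r
  simp only [circleMap, zero_add] at this ⊢
  rw [this]; ring

/-- Two functions with the same circle averages about `c`, against a radial weight. -/
theorem integral_radial_mul_congr {F G : ℂ → ℝ} {ψ : ℝ → ℝ} {c : ℂ}
    (hF : Integrable fun z => ψ ‖z - c‖ * F z) (hG : Integrable fun z => ψ ‖z - c‖ * G z)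
    (h : ∀ r, 0 < r → circleAverage F c r = circleAverage G c r) :
    ∫ z, ψ ‖z - c‖ * F z = ∫ z, ψ ‖z - c‖ * G z := by
  rw [integral_eq_integral_circleAverage hF c, integral_eq_integral_circleAverage hG c]
  refine setIntegral_congr_fun measurableSet_Ioi fun r hr => ?_
  have hr0 : (0 : ℝ) < r := hr
  have key : ∀ H : ℂ → ℝ, circleAverage (fun z => ψ ‖z - c‖ * H z) c r
      = ψ r * circleAverage H c r := by
    intro H
    simp only [circleAverage_def, smul_eq_mul, circleMap_sub_center, norm_circleMap_zero,
      abs_of_pos hr0, intervalIntegral.integral_const_mul]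
    ring
  simp only [key, h r hr0]

theorem circleAverage_log_norm_sub (c w : ℂ) {r : ℝ} (hr : 0 < r) :
    circleAverage (fun z => log ‖z - w‖) c r = log (max r ‖w - c‖) := by
  rw [circleAverage_log_norm_sub_const_eq_log_radius_add_posLog hr.ne', norm_sub_rev c w]
  rcases le_total ‖w - c‖ r with h | h
  · rw [max_eq_left h, (posLog_eq_zero_iff _).2, add_zero]
    rw [abs_of_nonneg (by positivity), inv_mul_le_iff₀ hr]; linarith
  · rw [max_eq_right h, posLog_eq_log, log_mul (by positivity) (by linarith), log_inv]
    · ring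
    · rw [abs_of_nonneg (by positivity), le_inv_mul_iff₀ hr]; linarith

/-- Bounded measurable functions with bounded support. -/
structure IsTame (f : ℂ → ℝ) : Prop where
  measurable : Measurable f
  bounded : ∃ B, ∀ w, |f w| ≤ B
  support : ∃ ρ, ∀ w, ρ ≤ ‖w‖ → f w = 0

/-- The logarithmic potential `∫ log (1 / |z - w|) f(w) dλ(w)`. -/
noncomputable def logPot (f : ℂ → ℝ) (z : ℂ) : ℝ := ∫ w, -log ‖z - w‖ * f w

/-- The mean of `logPot f` over the circle of radius `r` about `c`, in closed form. -/
noncomputable def ringPot (f : ℂ → ℝ) (c : ℂ) (r : ℝ) : ℝ :=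
  ∫ w, -log (max r ‖w - c‖) * f w

/-- The half-open annulus `{z | t₁ ≤ |z - c| < t₂}`. -/
def annulus (c : ℂ) (t₁ t₂ : ℝ) : Set ℂ := {z | t₁ ≤ ‖z - c‖ ∧ ‖z - c‖ < t₂}

theorem measurableSet_annulus (c : ℂ) (t₁ t₂ : ℝ) : MeasurableSet (annulus c t₁ t₂) := by
  have h : Measurable fun z : ℂ => ‖z - c‖ := by fun_prop
  exact (measurableSet_le measurable_const h).inter (measurableSet_lt h measurable_const)

theorem annulus_subset_ball (c : ℂ) (t₁ t₂ : ℝ) : annulus c t₁ t₂ ⊆ ball c t₂ :=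
  fun z hz => by simpa [mem_ball, dist_eq_norm] using hz.2

theorem volume_real_ball (c : ℂ) {r : ℝ} (hr : 0 ≤ r) : volume.real (ball c r) = π * r ^ 2 := by
  rw [Measure.real, Complex.volume_ball]
  simp [ENNReal.toReal_ofReal hr, mul_comm]

theorem volume_real_annulus (c : ℂ) {t₁ t₂ : ℝ} (h1 : 0 ≤ t₁) (h12 : t₁ ≤ t₂) :
    volume.real (annulus c t₁ t₂) = π * (t₂ ^ 2 - t₁ ^ 2) := by
  have : annulus c t₁ t₂ = ball c t₂ \ ball c t₁ := by
    ext z; simp [annulus, mem_ball, dist_eq_norm, and_comm]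
  rw [this, measureReal_sdiff (ball_subset_ball h12) measurableSet_ball,
    volume_real_ball c (h1.trans h12), volume_real_ball c h1]
  ring

theorem volume_annulus_ne_top (c : ℂ) (t₁ t₂ : ℝ) : volume (annulus c t₁ t₂) ≠ ∞ :=
  ((measure_mono (annulus_subset_ball c t₁ t₂)).trans_lt measure_ball_lt_top).ne

namespace IsTame

variable {f g : ℂ → ℝ}

theorem exists_bound (hf : IsTame f) :
    ∃ B ρ : ℝ, 0 < B ∧ 0 < ρ ∧ (∀ w, |f w| ≤ B) ∧ ∀ w, ρ ≤ ‖w‖ → f w = 0 := by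
  obtain ⟨B, hB⟩ := hf.bounded
  obtain ⟨ρ, hρ⟩ := hf.support
  exact ⟨max B 1, max ρ 1, by positivity, by positivity, fun w => (hB w).trans (le_max_left _ _),
    fun w hw => hρ w ((le_max_left _ _).trans hw)⟩

theorem integrable (hf : IsTame f) : Integrable f := by
  obtain ⟨B, ρ, hB, hρ, h1, h2⟩ := hf.exists_bound
  have : Integrable ((ball (0 : ℂ) ρ).indicator fun _ => B) :=
    (integrable_indicator_iff measurableSet_ball).2 (integrableOn_const measure_ball_lt_top.ne)
  refine this.mono' hf.measurable.aestronglyMeasurable (.of_forall fun w => ?_)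
  by_cases hw : w ∈ ball (0 : ℂ) ρ
  · simpa [hw] using h1 w
  · rw [indicator_of_notMem hw, h2 w (by simpa using hw)]; simp

theorem indicator (hf : IsTame f) {s : Set ℂ} (hs : MeasurableSet s) : IsTame (s.indicator f) := by
  obtain ⟨B, ρ, hB, hρ, h1, h2⟩ := hf.exists_bound
  refine ⟨hf.measurable.indicator hs, ⟨B, fun w => ?_⟩, ⟨ρ, fun w hw => ?_⟩⟩
  · by_cases h : w ∈ s <;> simp [h, h1 w, hB.le]
  · by_cases h : w ∈ s <;> simp [h, h2 w hw]

theorem of_bounded_on_ball {ψ : ℂ → ℝ} {c : ℂ} {t B : ℝ} (hm : Measurable ψ)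
    (hb : ∀ z ∈ ball c t, |ψ z| ≤ B) (h0 : ∀ z, z ∉ ball c t → ψ z = 0) : IsTame ψ := by
  refine ⟨hm, ⟨max B 0, fun w => ?_⟩, ⟨‖c‖ + t, fun w hw => h0 w fun h => ?_⟩⟩
  · by_cases h : w ∈ ball c t
    · exact (hb w h).trans (le_max_left _ _)
    · simp [h0 w h]
  · rw [mem_ball, dist_eq_norm] at h
    have := norm_sub_norm_le w c
    linarith

end IsTame

theorem abs_log_le_rpow {τ x : ℝ} (hx : 0 < x) (hxτ : x < τ) :
    |log x| ≤ (2 + τ ^ 2) * x ^ (-1 : ℝ) := by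
  rw [rpow_neg_one]
  rcases le_total x 1 with h | h
  · rw [abs_of_nonpos (log_nonpos hx.le h)]
    have := log_le_sub_one_of_pos (inv_pos.2 hx)
    rw [log_inv] at this
    have h3 : 0 < x⁻¹ := inv_pos.2 hx
    nlinarith [sq_nonneg τ]
  · rw [abs_of_nonneg (log_nonneg h)]
    have := log_le_sub_one_of_pos hx
    rw [← div_eq_mul_inv, le_div_iff₀ hx]
    nlinarith

theorem integrableOn_log_norm_ball (τ : ℝ) : IntegrableOn (fun w : ℂ => log ‖w‖) (ball 0 τ) := by
  refine integrableOn_ball_of_norm_le_rpow (C := 2 + τ ^ 2) (α := 1) (by simp) (by simp) ?_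
    (Measurable.aestronglyMeasurable (by fun_prop))
  filter_upwards [ae_restrict_mem measurableSet_ball] with w hw
  rcases eq_or_ne w 0 with rfl | h0
  · simp [zero_rpow]
  · exact abs_log_le_rpow (norm_pos_iff.2 h0) (by simpa using hw)

theorem integrableOn_log_norm_sub (z c : ℂ) (t : ℝ) :
    IntegrableOn (fun w => log ‖z - w‖) (ball c t) := by
  have h := (((integrable_indicator_iff measurableSet_ball).2
    (integrableOn_log_norm_ball (‖z - c‖ + t))).comp_sub_left z).integrableOn (s := ball c t)
  refine h.congr_fun (fun w hw => ?_) measurableSet_ball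
  have : z - w ∈ ball (0 : ℂ) (‖z - c‖ + t) := by
    rw [mem_ball_zero_iff]
    rw [mem_ball, dist_eq_norm, norm_sub_rev] at hw
    calc ‖z - w‖ = ‖(z - c) + (c - w)‖ := by ring_nf
      _ ≤ _ := norm_add_le _ _
      _ < _ := by linarith
  simp only [indicator_of_mem this]

/-- A translation-invariant integrable majorant of the logarithmic kernel against a tame
density. -/
theorem IsTame.exists_majorant {f : ℂ → ℝ} (hf : IsTame f) (σ : ℝ) :
    ∃ L : ℂ → ℝ, Integrable L ∧ (∀ y, 0 ≤ L y) ∧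
      ∀ z, ‖z‖ < σ → ∀ w, |log ‖z - w‖ * f w| ≤ L (z - w) := by
  obtain ⟨B, ρ, hB, hρ, h1, h2⟩ := hf.exists_bound
  refine ⟨(ball (0 : ℂ) (σ + ρ)).indicator fun y => B * |log ‖y‖|,
    (integrable_indicator_iff measurableSet_ball).2
      ((integrableOn_log_norm_ball _).abs.const_mul B),
    fun y => indicator_nonneg (fun _ _ => by positivity) _, fun z hz w => ?_⟩
  by_cases hw : ρ ≤ ‖w‖
  · rw [h2 w hw]
    simpa using indicator_nonneg (fun _ _ => by positivity) _
  · have : z - w ∈ ball (0 : ℂ) (σ + ρ) := by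
      rw [mem_ball_zero_iff]
      have := norm_sub_le z w
      linarith
    rw [indicator_of_mem this, abs_mul, mul_comm]
    gcongr
    exact h1 w

namespace IsTame

variable {f g : ℂ → ℝ}

theorem integrable_log_mul (hf : IsTame f) (z : ℂ) : Integrable fun w => log ‖z - w‖ * f w := by
  obtain ⟨L, hL, h0, h⟩ := hf.exists_majorant (‖z‖ + 1)
  refine (hL.comp_sub_left z).mono' ?_ (.of_forall fun w => h z (by linarith) w)
  have := hf.measurable
  exact Measurable.aestronglyMeasurable (by fun_prop)

theorem exists_integral_abs_log_mul_le (hf : IsTame f) (σ : ℝ) :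
    ∃ B, ∀ z, ‖z‖ < σ → ∫ w, |log ‖z - w‖ * f w| ≤ B := by
  obtain ⟨L, hL, h0, h⟩ := hf.exists_majorant σ
  refine ⟨∫ y, L y, fun z hz => ?_⟩
  rw [← integral_sub_left_eq_self L volume z]
  exact integral_mono (hf.integrable_log_mul z).abs (hL.comp_sub_left z) (h z hz)

theorem exists_abs_logPot_le (hf : IsTame f) (σ : ℝ) :
    ∃ B, ∀ z, ‖z‖ < σ → |logPot f z| ≤ B := by
  obtain ⟨B, hB⟩ := hf.exists_integral_abs_log_mul_le σ
  refine ⟨B, fun z hz => le_trans ?_ (hB z hz)⟩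
  simp only [logPot, neg_mul, integral_neg, abs_neg]
  exact abs_integral_le_integral_abs

theorem measurable_logPot (hf : IsTame f) : Measurable (logPot f) := by
  have := hf.measurable
  have h : StronglyMeasurable (Function.uncurry fun z w : ℂ => -log ‖z - w‖ * f w) :=
    Measurable.stronglyMeasurable (by unfold Function.uncurry; fun_prop)
  exact h.integral_prod_right.measurable

theorem measurable_ringPot (hf : IsTame f) (c : ℂ) : Measurable (ringPot f c) := by
  have := hf.measurable
  have h : StronglyMeasurable (Function.uncurry fun (r : ℝ) (w : ℂ) =>
      -log (max r ‖w - c‖) * f w) :=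
    Measurable.stronglyMeasurable (by unfold Function.uncurry; fun_prop)
  exact h.integral_prod_right.measurable

theorem integrable_prod_log (hf : IsTame f) (hg : IsTame g) :
    Integrable (fun p : ℂ × ℂ => g p.1 * (-log ‖p.1 - p.2‖ * f p.2))
      (volume.prod volume) := by
  have := hf.measurable
  have := hg.measurable
  obtain ⟨B, ρ, hB, hρ, h1, h2⟩ := hg.exists_bound
  obtain ⟨L, hL, h0, h⟩ := hf.exists_majorant ρ
  have hprod : Integrable (fun p : ℂ × ℂ => |g p.1| * L p.2) (volume.prod volume) :=
    hg.integrable.abs.mul_prod hL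
  have hsh : Integrable (fun p : ℂ × ℂ => |g p.1| * L (p.1 - p.2)) (volume.prod volume) := by
    refine (integrable_prod_iff ?_).2 ⟨.of_forall fun z => (hL.comp_sub_left z).const_mul |g z|, ?_⟩
    · refine (hg.integrable.abs.aestronglyMeasurable.comp_quasiMeasurePreserving
        Measure.quasiMeasurePreserving_fst).mul
        (hL.aestronglyMeasurable.comp_quasiMeasurePreserving
          (quasiMeasurePreserving_sub volume volume))
    · have e : ∀ z, ∫ w, ‖|g z| * L (z - w)‖ = |g z| * ∫ y, L y := by
        intro z
        simp_rw [norm_mul, norm_eq_abs, abs_abs, abs_of_nonneg (h0 _)]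
        rw [integral_const_mul, integral_sub_left_eq_self]
      simp_rw [e]
      exact hg.integrable.abs.mul_const _
  refine hsh.mono' (Measurable.aestronglyMeasurable (by fun_prop)) (.of_forall fun p => ?_)
  rw [norm_mul, norm_eq_abs, norm_eq_abs, neg_mul, abs_neg]
  by_cases hp : ρ ≤ ‖p.1‖
  · simp [h2 _ hp]
  · gcongr
    exact h _ (not_le.1 hp) _

theorem integrable_log_max_mul (hf : IsTame f) (c : ℂ) (r : ℝ) :
    Integrable fun w => log (max r ‖w - c‖) * f w := by
  have hm := hf.measurable
  have h1 := (hf.integrable.abs.const_mul |log r|).add (hf.integrable_log_mul c).abs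
  refine h1.mono' (Measurable.aestronglyMeasurable (by fun_prop)) (.of_forall fun w => ?_)
  simp only [Pi.add_apply, norm_mul, norm_eq_abs, abs_mul, norm_sub_rev c w, ← add_mul]
  gcongr
  rcases max_choice r ‖w - c‖ with h | h <;> rw [h]
  · linarith [abs_nonneg (log ‖w - c‖)]
  · linarith [abs_nonneg (log r)]

theorem integrable_prod_log_max (hf : IsTame f) (hg : IsTame g) (c : ℂ) :
    Integrable (fun p : ℂ × ℂ => g p.1 * (-log (max ‖p.1 - c‖ ‖p.2 - c‖) * f p.2))
      (volume.prod volume) := by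
  have := hf.measurable
  have := hg.measurable
  have h1 := ((hg.integrable_log_mul c).abs.mul_prod hf.integrable.abs).add
    (hg.integrable.abs.mul_prod (hf.integrable_log_mul c).abs)
  refine h1.mono' (Measurable.aestronglyMeasurable (by fun_prop)) (.of_forall fun p => ?_)
  simp only [Pi.add_apply, norm_mul, norm_eq_abs, abs_mul, abs_neg, norm_sub_rev c]
  have : |log (max ‖p.1 - c‖ ‖p.2 - c‖)| ≤ |log ‖p.1 - c‖| + |log ‖p.2 - c‖| := by
    rcases max_choice ‖p.1 - c‖ ‖p.2 - c‖ with h | h <;> rw [h]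
    · linarith [abs_nonneg (log ‖p.2 - c‖)]
    · linarith [abs_nonneg (log ‖p.1 - c‖)]
  calc _ ≤ |g p.1| * ((|log ‖p.1 - c‖| + |log ‖p.2 - c‖|) * |f p.2|) := by gcongr
    _ = _ := by ring

end IsTame

theorem circleAverage_log_max (c w : ℂ) {r : ℝ} (hr : 0 < r) :
    circleAverage (fun z => log (max ‖z - c‖ ‖w - c‖)) c r = log (max r ‖w - c‖) := by
  simp only [circleAverage_def, circleMap_sub_center, norm_circleMap_zero, abs_of_pos hr,
    intervalIntegral.integral_const, smul_eq_mul]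
  field_simp
  ring

/-- Against a radial weight, the logarithmic kernel may be replaced by its circle means. -/
theorem integral_radial_mul_log {ψ : ℝ → ℝ} {c : ℂ} (hψ : IsTame fun z => ψ ‖z - c‖) (w : ℂ) :
    ∫ z, ψ ‖z - c‖ * log ‖z - w‖ = ∫ z, ψ ‖z - c‖ * log (max ‖z - c‖ ‖w - c‖) := by
  refine integral_radial_mul_congr ?_ ?_ fun r hr => ?_
  · refine (hψ.integrable_log_mul w).congr (.of_forall fun z => ?_)
    simp only [norm_sub_rev w z, mul_comm]
  · refine (hψ.integrable_log_max_mul c ‖w - c‖).congr (.of_forall fun z => ?_)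
    simp only [max_comm ‖w - c‖, mul_comm]
  · rw [circleAverage_log_norm_sub c w hr, circleAverage_log_max c w hr]

theorem integral_radial_mul_logPot {f : ℂ → ℝ} {ψ : ℝ → ℝ} {c : ℂ} (hf : IsTame f)
    (hψ : IsTame fun z => ψ ‖z - c‖) :
    ∫ z, ψ ‖z - c‖ * logPot f z = ∫ z, ψ ‖z - c‖ * ringPot f c ‖z - c‖ := by
  simp only [logPot, ringPot, ← integral_const_mul]
  refine (integral_integral_swap (f := fun z w => ψ ‖z - c‖ * (-log ‖z - w‖ * f w))
    (hf.integrable_prod_log hψ)).trans (Eq.trans ?_ (integral_integral_swap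
    (f := fun z w => ψ ‖z - c‖ * (-log (max ‖z - c‖ ‖w - c‖) * f w))
    (hf.integrable_prod_log_max hψ c)).symm)
  congr 1; ext w
  have h := integral_radial_mul_log hψ w
  have e : ∀ x y : ℂ → ℝ, (∫ z, x z * (-y z * f w)) = -(∫ z, x z * y z) * f w := by
    intro x y
    rw [← integral_neg, ← integral_mul_const]
    congr 1; ext z; ring
  rw [e, e, h]

theorem IsTame.abs_ringPot_le {f : ℂ → ℝ} (hf : IsTame f) (c : ℂ) {t₁ t₂ : ℝ} (h1 : 0 < t₁) :
    ∃ B, ∀ r, t₁ ≤ r → r < t₂ → |ringPot f c r| ≤ B := by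
  refine ⟨∫ w, (|log t₁| + |log t₂|) * |f w| + |log ‖c - w‖ * f w|, fun r hr hr2 => ?_⟩
  simp only [ringPot, neg_mul, integral_neg, abs_neg]
  refine abs_integral_le_integral_abs.trans (integral_mono (hf.integrable_log_max_mul c r).abs
    ((hf.integrable.abs.const_mul _).add (hf.integrable_log_mul c).abs) fun w => ?_)
  simp only [abs_mul, norm_sub_rev c w, ← add_mul]
  gcongr
  have hr0 : 0 < r := h1.trans_le hr
  have ha : |log r| ≤ |log t₁| + |log t₂| := by
    have h3 := log_le_log h1 hr
    have h4 := log_le_log hr0 hr2.le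
    rw [abs_le]
    constructor
    · linarith [neg_abs_le (log t₁), abs_nonneg (log t₂)]
    · linarith [le_abs_self (log t₂), abs_nonneg (log t₁)]
  rcases max_choice r ‖w - c‖ with h | h <;> rw [h]
  · linarith [abs_nonneg (log ‖w - c‖)]
  · linarith [abs_nonneg (log t₁), abs_nonneg (log t₂)]

theorem IsTame.integrableOn_exp_logPot {f : ℂ → ℝ} (hf : IsTame f) (k : ℝ) (c : ℂ) (t : ℝ) :
    IntegrableOn (fun z => exp (k * logPot f z)) (ball c t) := by
  obtain ⟨B, hB⟩ := hf.exists_abs_logPot_le (‖c‖ + t)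
  have := hf.measurable_logPot
  refine Measure.integrableOn_of_bounded (M := exp (|k| * B)) measure_ball_lt_top.ne
    (Measurable.aestronglyMeasurable (by fun_prop)) ?_
  filter_upwards [ae_restrict_mem measurableSet_ball] with z hz
  rw [norm_of_nonneg (exp_pos _).le, exp_le_exp]
  rw [mem_ball, dist_eq_norm] at hz
  have h2 := hB z (by have := norm_sub_norm_le z c; linarith)
  calc k * logPot f z ≤ |k * logPot f z| := le_abs_self _
    _ = |k| * |logPot f z| := abs_mul _ _
    _ ≤ _ := by gcongr

/-- Jensen's inequality on circles, integrated over an annulus. -/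
theorem integral_exp_ringPot_le {f : ℂ → ℝ} (hf : IsTame f) (c : ℂ) {t₁ t₂ : ℝ} (h1 : 0 < t₁) :
    ∫ z in annulus c t₁ t₂, exp (ringPot f c ‖z - c‖) ≤
      ∫ z in annulus c t₁ t₂, exp (logPot f z) := by
  obtain ⟨B, hB⟩ := hf.abs_ringPot_le c (t₂ := t₂) h1
  have hmQ := hf.measurable_ringPot c
  have hmU := hf.measurable_logPot
  set ψ : ℝ → ℝ := (Ico t₁ t₂).indicator fun r => exp (ringPot f c r) with hψ
  have hψm : Measurable ψ := (by fun_prop : Measurable fun r => exp (ringPot f c r)).indicator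
    measurableSet_Ico
  have hψt : IsTame fun z => ψ ‖z - c‖ := by
    refine IsTame.of_bounded_on_ball (c := c) (t := t₂) (B := exp B) (by fun_prop)
      (fun z _ => ?_) fun z hz => ?_
    · by_cases h : ‖z - c‖ ∈ Ico t₁ t₂
      · rw [hψ, indicator_of_mem h, abs_of_pos (exp_pos _), exp_le_exp]
        exact (le_abs_self _).trans (hB _ h.1 h.2)
      · rw [hψ, indicator_of_notMem h, abs_zero]; positivity
    · rw [hψ, indicator_of_notMem]
      intro h
      exact hz (by simpa [mem_ball, dist_eq_norm] using h.2)
  have hind : ∀ G : ℂ → ℝ, (annulus c t₁ t₂).indicator (fun z => exp (ringPot f c ‖z - c‖) * G z)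
      = fun z => ψ ‖z - c‖ * G z := by
    intro G
    ext z
    by_cases h : z ∈ annulus c t₁ t₂
    · rw [indicator_of_mem h, hψ, indicator_of_mem (show ‖z - c‖ ∈ Ico t₁ t₂ from h)]
    · rw [indicator_of_notMem h, hψ, indicator_of_notMem (show ‖z - c‖ ∉ Ico t₁ t₂ from h), zero_mul]
  have hfin := volume_annulus_ne_top c t₁ t₂
  have hQi : IntegrableOn (fun z => exp (ringPot f c ‖z - c‖)) (annulus c t₁ t₂) := by
    refine Measure.integrableOn_of_bounded (M := exp B) hfin
      (Measurable.aestronglyMeasurable (by fun_prop)) ?_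
    filter_upwards [ae_restrict_mem (measurableSet_annulus c t₁ t₂)] with z hz
    rw [norm_of_nonneg (exp_pos _).le, exp_le_exp]
    exact (le_abs_self _).trans (hB _ hz.1 hz.2)
  have hQQ : IntegrableOn (fun z => exp (ringPot f c ‖z - c‖) * ringPot f c ‖z - c‖)
      (annulus c t₁ t₂) := by
    refine Integrable.mono' (hQi.mul_const B) (Measurable.aestronglyMeasurable (by fun_prop)) ?_
    filter_upwards [ae_restrict_mem (measurableSet_annulus c t₁ t₂)] with z hz
    rw [norm_mul, norm_of_nonneg (exp_pos _).le]
    gcongr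
    exact hB _ hz.1 hz.2
  obtain ⟨B', hB'⟩ := hf.exists_abs_logPot_le (‖c‖ + t₂)
  have hQU : IntegrableOn (fun z => exp (ringPot f c ‖z - c‖) * logPot f z)
      (annulus c t₁ t₂) := by
    refine Integrable.mono' (hQi.mul_const B') (Measurable.aestronglyMeasurable (by fun_prop)) ?_
    filter_upwards [ae_restrict_mem (measurableSet_annulus c t₁ t₂)] with z hz
    rw [norm_mul, norm_of_nonneg (exp_pos _).le]
    gcongr
    exact hB' _ (by have := norm_sub_norm_le z c; linarith [hz.2])
  have hUi : IntegrableOn (fun z => exp (logPot f z)) (annulus c t₁ t₂) := by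
    simpa using (hf.integrableOn_exp_logPot 1 c t₂).mono_set (annulus_subset_ball c t₁ t₂)
  have key := integral_radial_mul_logPot hf hψt
  rw [← hind, ← hind, integral_indicator (measurableSet_annulus c t₁ t₂),
    integral_indicator (measurableSet_annulus c t₁ t₂)] at key
  have hle : ∫ z in annulus c t₁ t₂, (exp (ringPot f c ‖z - c‖) +
      (exp (ringPot f c ‖z - c‖) * logPot f z -
        exp (ringPot f c ‖z - c‖) * ringPot f c ‖z - c‖)) ≤
      ∫ z in annulus c t₁ t₂, exp (logPot f z) := by
    refine integral_mono (hQi.add (hQU.sub hQQ)) hUi fun z => ?_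
    simp only
    have h := add_one_le_exp (logPot f z - ringPot f c ‖z - c‖)
    have e : exp (logPot f z)
        = exp (ringPot f c ‖z - c‖) * exp (logPot f z - ringPot f c ‖z - c‖) := by
      rw [← exp_add]; ring_nf
    rw [e]
    nlinarith [exp_pos (ringPot f c ‖z - c‖)]
  have hs : IntegrableOn (fun z => exp (ringPot f c ‖z - c‖) * logPot f z -
        exp (ringPot f c ‖z - c‖) * ringPot f c ‖z - c‖) (annulus c t₁ t₂) := hQU.sub hQQ
  rw [integral_add hQi hs, integral_sub hQU hQQ, key] at hle
  linarith

/-- For a positive measure `f dλ` of mass at most `κ`, a form of Jensen's inequality. -/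
theorem exp_integral_mul_le {f φ : ℂ → ℝ} {κ : ℝ} (hκ : 0 < κ) (hf0 : ∀ w, 0 ≤ f w)
    (hf : Integrable f) (hφ : Integrable fun w => φ w * f w)
    (hexp : Integrable fun w => exp (κ * φ w) * f w) (hm : ∫ w, f w ≤ κ) :
    exp (∫ w, φ w * f w) ≤ 1 + κ⁻¹ * ∫ w, exp (κ * φ w) * f w := by
  set q := ∫ w, φ w * f w with hq
  set m := ∫ w, f w with hm'
  have hm0 : 0 ≤ m := integral_nonneg hf0
  have h1 : ∫ w, exp q * ((1 - q) * f w + κ * (φ w * f w)) ≤ ∫ w, exp (κ * φ w) * f w := by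
    refine integral_mono (((hf.const_mul _).add (hφ.const_mul _)).const_mul _) hexp fun w => ?_
    have h := add_one_le_exp (κ * φ w - q)
    have e : exp (κ * φ w) = exp q * exp (κ * φ w - q) := by rw [← exp_add]; ring_nf
    simp only [e]
    have h3 := mul_le_mul_of_nonneg_left h (mul_nonneg (exp_pos q).le (hf0 w))
    calc _ = exp q * f w * (κ * φ w - q + 1) := by ring
      _ ≤ _ := h3
      _ = _ := by ring
  rw [integral_const_mul, integral_add (hf.const_mul _) (hφ.const_mul _), integral_const_mul,
    integral_const_mul, ← hq, ← hm'] at h1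
  have h2 : exp q - 1 ≤ q * exp q := by
    have h := add_one_le_exp (-q)
    have : exp (-q) * exp q = 1 := by rw [← exp_add]; simp
    nlinarith [exp_pos q]
  have h3 : κ * (exp q - 1) ≤ ∫ w, exp (κ * φ w) * f w := by
    nlinarith [mul_nonneg (sub_nonneg.2 hm) (sub_nonneg.2 h2)]
  rw [← sub_le_iff_le_add', le_inv_mul_iff₀ hκ]
  exact h3

theorem IsTame.integrable_neg_log_mul {f : ℂ → ℝ} (hf : IsTame f) (z : ℂ) :
    Integrable fun w => -log ‖z - w‖ * f w :=
  (hf.integrable_log_mul z).neg.congr (.of_forall fun w => by simp)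

theorem IsTame.integrable_neg_log_max_mul {f : ℂ → ℝ} (hf : IsTame f) (c : ℂ) (r : ℝ) :
    Integrable fun w => -log (max r ‖w - c‖) * f w :=
  (hf.integrable_log_max_mul c r).neg.congr (.of_forall fun w => by simp)

section mass

variable {f : ℂ → ℝ} {c : ℂ} {R r r' : ℝ}

theorem ringPot_sub_ringPot (hf : IsTame f) (c : ℂ) (r r' : ℝ) :
    ringPot f c r - ringPot f c r' =
      ∫ w, (log (max r' ‖w - c‖) - log (max r ‖w - c‖)) * f w := by
  have h1 := hf.integrable_log_max_mul c r
  have h2 := hf.integrable_log_max_mul c r'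
  simp only [ringPot, neg_mul, integral_neg, sub_mul]
  rw [integral_sub h2 h1]; ring

theorem integrable_log_max_sub_mul (hf : IsTame f) (c : ℂ) (r r' : ℝ) :
    Integrable fun w => (log (max r' ‖w - c‖) - log (max r ‖w - c‖)) * f w :=
  ((hf.integrable_log_max_mul c r').sub (hf.integrable_log_max_mul c r)).congr
    (.of_forall fun w => by simp [sub_mul])

theorem mass_mul_log_le (hf : IsTame f) (h0 : ∀ w ∈ ball c r', 0 ≤ f w) (hr : 0 < r)
    (hr' : r ≤ r') :
    (∫ w in ball c r, f w) * log (r' / r) ≤ ringPot f c r - ringPot f c r' := by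
  rw [ringPot_sub_ringPot hf, ← integral_indicator measurableSet_ball, ← integral_mul_const]
  refine integral_mono ((hf.integrable.indicator measurableSet_ball).mul_const _)
    (integrable_log_max_sub_mul hf c r r') fun w => ?_
  have hr0' : 0 < r' := hr.trans_le hr'
  by_cases hw : w ∈ ball c r
  · have hw' : ‖w - c‖ < r := by simpa [mem_ball, dist_eq_norm] using hw
    simp only [indicator_of_mem hw]
    rw [max_eq_left hw'.le, max_eq_left (hw'.le.trans hr'), log_div hr0'.ne' hr.ne', mul_comm]
  · simp only [indicator_of_notMem hw, zero_mul]
    by_cases hw' : w ∈ ball c r'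
    · refine mul_nonneg (sub_nonneg.2 (log_le_log (by positivity) ?_)) (h0 w hw')
      exact max_le_max hr' le_rfl
    · have : r' ≤ ‖w - c‖ := by simpa [mem_ball, dist_eq_norm] using hw'
      rw [max_eq_right this, max_eq_right (hr'.trans this)]; simp

theorem ringPot_sub_le (hf : IsTame f) (h0 : ∀ w ∈ ball c r', 0 ≤ f w) (hr : 0 < r)
    (hr' : r ≤ r') :
    ringPot f c r - ringPot f c r' ≤ (∫ w in ball c r', f w) * log (r' / r) := by
  rw [ringPot_sub_ringPot hf, ← integral_indicator measurableSet_ball, ← integral_mul_const]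
  refine integral_mono (integrable_log_max_sub_mul hf c r r')
    ((hf.integrable.indicator measurableSet_ball).mul_const _) fun w => ?_
  have hr0' : 0 < r' := hr.trans_le hr'
  by_cases hw : w ∈ ball c r'
  · have hw' : ‖w - c‖ < r' := by simpa [mem_ball, dist_eq_norm] using hw
    simp only [indicator_of_mem hw]
    rw [mul_comm (f w), log_div hr0'.ne' hr.ne', max_eq_left hw'.le]
    refine mul_le_mul_of_nonneg_right (sub_le_sub_left (log_le_log hr (le_max_left _ _)) _)
      (h0 w hw)
  · simp only [indicator_of_notMem hw, zero_mul]
    have : r' ≤ ‖w - c‖ := by simpa [mem_ball, dist_eq_norm] using hw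
    rw [max_eq_right this, max_eq_right (hr'.trans this)]; simp

theorem ringPot_anti (hf : IsTame f) (h0 : ∀ w ∈ ball c r', 0 ≤ f w) (hr : 0 < r)
    (hr' : r ≤ r') : ringPot f c r' ≤ ringPot f c r := by
  have h := mass_mul_log_le hf h0 hr hr'
  have h1 : 0 ≤ ∫ w in ball c r, f w :=
    setIntegral_nonneg measurableSet_ball fun w hw => h0 w (ball_subset_ball hr' hw)
  have h2 : 0 ≤ log (r' / r) := log_nonneg ((one_le_div hr).2 hr')
  nlinarith [mul_nonneg h1 h2]

theorem area_mul_exp_ringPot_le (hf : IsTame f) (h0 : ∀ w ∈ ball c r, 0 ≤ f w) (hr : 0 < r) :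
    3 / 4 * π * r ^ 2 * exp (ringPot f c r) ≤ ∫ z in annulus c (r / 2) r, exp (logPot f z) := by
  refine le_trans ?_ (integral_exp_ringPot_le hf c (half_pos hr))
  have hv : volume.real (annulus c (r / 2) r) = 3 / 4 * π * r ^ 2 := by
    rw [volume_real_annulus c (by positivity) (by linarith)]; ring
  rw [← hv, mul_comm]
  obtain ⟨B, hB⟩ := hf.abs_ringPot_le c (t₂ := r) (half_pos hr)
  have hmQ := hf.measurable_ringPot c
  refine setIntegral_ge_of_const_le_real (measurableSet_annulus _ _ _)
    (volume_annulus_ne_top _ _ _) (fun z hz => ?_) ?_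
  · rw [exp_le_exp]
    refine ringPot_anti hf h0 ((half_pos hr).trans_le hz.1) hz.2.le
  · refine Measure.integrableOn_of_bounded (M := exp B) (volume_annulus_ne_top _ _ _)
      (Measurable.aestronglyMeasurable (by fun_prop)) ?_
    filter_upwards [ae_restrict_mem (measurableSet_annulus c (r / 2) r)] with z hz
    rw [norm_of_nonneg (exp_pos _).le, exp_le_exp]
    exact (le_abs_self _).trans (hB _ hz.1 hz.2)

end mass

/-- The kernel `log⁺ (τ / |y|)`. -/
noncomputable def truncLog (τ : ℝ) (y : ℂ) : ℝ :=
  (ball (0 : ℂ) τ).indicator (fun y => log τ - log ‖y‖) y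

/-- The kernel `(τ / |y|) ^ (3 / 2)`, cut off at `|y| = τ`. -/
noncomputable def truncPow (τ : ℝ) (y : ℂ) : ℝ :=
  (ball (0 : ℂ) τ).indicator (fun y => exp (3 / 2 * truncLog τ y)) y

theorem truncPow_nonneg (τ : ℝ) (y : ℂ) : 0 ≤ truncPow τ y :=
  indicator_nonneg (fun _ _ => (exp_pos _).le) _

theorem truncPow_eq_of_ne {τ : ℝ} (hτ : 0 < τ) {y : ℂ} (hy : y ≠ 0) :
    truncPow τ y = (Iio τ).indicator (fun r => τ ^ (3 / 2 : ℝ) * r ^ (-(3 / 2) : ℝ)) ‖y‖ := by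
  by_cases h : ‖y‖ < τ
  · have h1 : y ∈ ball (0 : ℂ) τ := by simpa using h
    have h2 : ‖y‖ ∈ Iio τ := h
    rw [truncPow, indicator_of_mem h1, truncLog, indicator_of_mem h1, indicator_of_mem h2,
      rpow_def_of_pos hτ, rpow_def_of_pos (norm_pos_iff.2 hy), ← exp_add]
    ring_nf
  · have h1 : y ∉ ball (0 : ℂ) τ := by simpa using h
    have h2 : ‖y‖ ∉ Iio τ := h
    rw [truncPow, indicator_of_notMem h1, indicator_of_notMem h2]

theorem truncPow_ae_eq {τ : ℝ} (hτ : 0 < τ) : truncPow τ =ᵐ[volume]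
    fun y => (Iio τ).indicator (fun r => τ ^ (3 / 2 : ℝ) * r ^ (-(3 / 2) : ℝ)) ‖y‖ := by
  have : ∀ᵐ y : ℂ, y ≠ 0 := by simp [ae_iff]
  filter_upwards [this] with y hy using truncPow_eq_of_ne hτ hy

theorem setIntegral_radial_pow {τ : ℝ} (hτ : 0 < τ) :
    IntegrableOn (fun r : ℝ => r ^ (-(1 / 2) : ℝ)) (Ioo 0 τ) ∧
    ∫ r in Ioo 0 τ, r ^ (-(1 / 2) : ℝ) = 2 * τ ^ (1 / 2 : ℝ) := by
  constructor
  · rw [← intervalIntegrable_iff_integrableOn_Ioo_of_le hτ.le]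
    exact intervalIntegral.intervalIntegrable_rpow' (by norm_num)
  · rw [← integral_Ioc_eq_integral_Ioo, ← intervalIntegral.integral_of_le hτ.le,
      integral_rpow (by norm_num)]
    norm_num
    ring

theorem integrable_truncPow {τ : ℝ} (hτ : 0 < τ) : Integrable (truncPow τ) := by
  refine Integrable.congr ?_ (truncPow_ae_eq hτ).symm
  rw [integrable_fun_norm_addHaar]
  have e : ∀ y ∈ Ioi (0 : ℝ), y ^ (Module.finrank ℝ ℂ - 1) •
      (Iio τ).indicator (fun r => τ ^ (3 / 2 : ℝ) * r ^ (-(3 / 2) : ℝ)) y =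
      (Iio τ).indicator (fun r => τ ^ (3 / 2 : ℝ) * r ^ (-(1 / 2) : ℝ)) y := by
    intro y hy
    by_cases h : y ∈ Iio τ
    · simp only [indicator_of_mem h, Complex.finrank_real_complex, smul_eq_mul]
      have : y ^ (-(1 / 2) : ℝ) = y * y ^ (-(3 / 2) : ℝ) := by
        rw [← rpow_one_add' hy.out.le (by norm_num)]; norm_num
      rw [this]; norm_num; ring
    · simp only [indicator_of_notMem h, smul_zero]
  refine IntegrableOn.congr_fun ?_ (fun y hy => (e y hy).symm) measurableSet_Ioi
  rw [IntegrableOn, integrable_indicator_iff measurableSet_Iio, IntegrableOn,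
    Measure.restrict_restrict measurableSet_Iio, inter_comm, Ioi_inter_Iio]
  exact (setIntegral_radial_pow hτ).1.const_mul _

theorem integral_truncPow {τ : ℝ} (hτ : 0 < τ) : ∫ y, truncPow τ y = 4 * π * τ ^ 2 := by
  rw [integral_congr_ae (truncPow_ae_eq hτ), integral_fun_norm_addHaar]
  have e : ∀ y ∈ Ioi (0 : ℝ), y ^ (Module.finrank ℝ ℂ - 1) •
      (Iio τ).indicator (fun r => τ ^ (3 / 2 : ℝ) * r ^ (-(3 / 2) : ℝ)) y =
      (Iio τ).indicator (fun r => τ ^ (3 / 2 : ℝ) * r ^ (-(1 / 2) : ℝ)) y := by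
    intro y hy
    by_cases h : y ∈ Iio τ
    · simp only [indicator_of_mem h, Complex.finrank_real_complex, smul_eq_mul]
      have : y ^ (-(1 / 2) : ℝ) = y * y ^ (-(3 / 2) : ℝ) := by
        rw [← rpow_one_add' hy.out.le (by norm_num)]; norm_num
      rw [this]; norm_num; ring
    · simp only [indicator_of_notMem h, smul_zero]
  rw [setIntegral_congr_fun measurableSet_Ioi e, integral_indicator measurableSet_Iio,
    Measure.restrict_restrict measurableSet_Iio, inter_comm, Ioi_inter_Iio, integral_const_mul,
    (setIntegral_radial_pow hτ).2, volume_real_ball 0 zero_le_one, Complex.finrank_real_complex]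
  have : τ ^ (3 / 2 : ℝ) * τ ^ (1 / 2 : ℝ) = τ ^ 2 := by
    rw [← rpow_add hτ]; norm_num
  simp only [smul_eq_mul, nsmul_eq_mul]
  linear_combination (2 * π * 2) * this

theorem integrable_truncLog (τ : ℝ) : Integrable (truncLog τ) :=
  (integrable_indicator_iff measurableSet_ball).2
    ((integrableOn_const measure_ball_lt_top.ne).sub (integrableOn_log_norm_ball τ))

theorem integrable_convolution_truncPow {f : ℂ → ℝ} (hf : IsTame f) {τ : ℝ} (hτ : 0 < τ) :
    Integrable (fun z => ∫ w, truncPow τ (z - w) * f w) ∧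
    ∫ z, ∫ w, truncPow τ (z - w) * f w = (∫ w, f w) * (4 * π * τ ^ 2) := by
  have hconv : (fun z => ∫ w, truncPow τ (z - w) * f w) =
      convolution f (truncPow τ) (ContinuousLinearMap.mul ℝ ℝ) volume := by
    ext z
    rw [convolution_def]
    simp only [ContinuousLinearMap.mul_apply', mul_comm]
  rw [hconv, integral_convolution _ hf.integrable (integrable_truncPow hτ),
    ContinuousLinearMap.mul_apply', integral_truncPow hτ]
  exact ⟨hf.integrable.integrable_convolution _ (integrable_truncPow hτ), rfl⟩

theorem IsTame.integrable_truncPow_mul {f : ℂ → ℝ} (hf : IsTame f) {τ : ℝ} (hτ : 0 < τ) (z : ℂ) :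
    Integrable fun w => truncPow τ (z - w) * f w := by
  obtain ⟨B, ρ, hB, hρ, hfB, -⟩ := hf.exists_bound
  exact ((integrable_truncPow hτ).comp_sub_left z).mul_bdd hf.measurable.aestronglyMeasurable
    (.of_forall hfB)

/-- Bound for the exponential of a potential near a point, in terms of a circle mean of the
potential. -/
theorem setIntegral_exp_logPot_le {f : ℂ → ℝ} (hf : IsTame f) (h0 : ∀ w, 0 ≤ f w)
    (hM : ∫ w, f w ≤ 2) {ε t : ℝ} (hε : 0 ≤ ε) (hε' : ε ≤ 1 / 8) (ht : 0 < t) {c : ℂ} {Y : Set ℂ}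
    (hY : MeasurableSet Y) (hYc : Y ⊆ ball c (2 * t))
    (hYm : ∀ z ∈ Y, ∫ w in ball z (t / 2), f w ≤ 4 / 3) :
    ∫ z in Y, exp ((1 + ε) * logPot f z) ≤
      750 * π * t ^ 2 * exp ((1 + ε) * ringPot f c t) := by
  set M := ∫ w, f w with hMdef
  have hM0 : 0 ≤ M := integral_nonneg h0
  have hfm := hf.measurable
  set τ := t / 2 with hτdef
  have hτ : 0 < τ := half_pos ht
  obtain ⟨B, ρ, hB, hρ, hfB, -⟩ := hf.exists_bound
  have hlogint : ∀ z, Integrable fun w => truncLog τ (z - w) * f w := fun z =>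
    ((integrable_truncLog τ).comp_sub_left z).mul_bdd hfm.aestronglyMeasurable
      (.of_forall hfB)
  have hpowint := fun z => hf.integrable_truncPow_mul hτ z
  -- pointwise bound of the potential
  have hpt : ∀ z ∈ Y, logPot f z ≤
      ringPot f c t + M * log 5 + ∫ w, truncLog τ (z - w) * f w := by
    intro z hz
    have hzc : ‖z - c‖ < 2 * t := by simpa [mem_ball, dist_eq_norm] using hYc hz
    have i1 := hf.integrable_neg_log_max_mul c t
    have i2 : Integrable fun w => f w * log 5 := hf.integrable.mul_const _
    have i3 : Integrable fun w => -log (max t ‖w - c‖) * f w + f w * log 5 := i1.add i2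
    rw [logPot, ringPot, hMdef, ← integral_mul_const, ← integral_add i1 i2,
      ← integral_add i3 (hlogint z)]
    refine integral_mono (hf.integrable_neg_log_mul z) (i3.add (hlogint z)) fun w => ?_
    · have hwc : ‖w - c‖ ≤ ‖z - w‖ + ‖z - c‖ := by
        rw [norm_sub_rev z w]
        calc ‖w - c‖ = ‖(w - z) + (z - c)‖ := by ring_nf
          _ ≤ _ := norm_add_le _ _
      have key : -log ‖z - w‖ ≤ -log (max t ‖w - c‖) + log 5 + truncLog τ (z - w) := by
        have hmax : 0 < max t ‖w - c‖ := lt_max_of_lt_left ht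
        by_cases h : ‖z - w‖ < τ
        · have h1 : z - w ∈ ball (0 : ℂ) τ := by simpa using h
          rw [truncLog, indicator_of_mem h1]
          have : log (max t ‖w - c‖) ≤ log (5 * τ) :=
            log_le_log hmax (max_le (by linarith) (by linarith))
          rw [log_mul (by norm_num) hτ.ne'] at this
          linarith
        · have h1 : z - w ∉ ball (0 : ℂ) τ := by simpa using h
          rw [truncLog, indicator_of_notMem h1]
          rw [not_lt] at h
          have hzw : 0 < ‖z - w‖ := hτ.trans_le h
          have : log (max t ‖w - c‖) ≤ log (5 * ‖z - w‖) :=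
            log_le_log hmax (max_le (by linarith) (by linarith))
          rw [log_mul (by norm_num) hzw.ne'] at this
          linarith
      have := mul_le_mul_of_nonneg_right key (h0 w)
      simp only
      linarith
  -- exponential of the near part
  have hnear : ∀ z ∈ Y, exp ((1 + ε) * ∫ w, truncLog τ (z - w) * f w) ≤
      1 + 3 / 4 * ∫ w, truncPow τ (z - w) * f w := by
    intro z hz
    set fz := (ball z τ).indicator fun w => (1 + ε) * f w with hfz
    have hmem : ∀ w, w ∈ ball z τ ↔ z - w ∈ ball (0 : ℂ) τ := fun w => by
      rw [mem_ball, dist_comm, dist_eq_norm, mem_ball_zero_iff]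
    have e1 : ∀ w, truncLog τ (z - w) * fz w = (1 + ε) * (truncLog τ (z - w) * f w) := by
      intro w
      by_cases h : w ∈ ball z τ
      · rw [hfz, indicator_of_mem h]; ring
      · rw [hfz, indicator_of_notMem h, truncLog, indicator_of_notMem (by rwa [← hmem])]; ring
    have e2 : ∀ w, exp (3 / 2 * truncLog τ (z - w)) * fz w =
        (1 + ε) * (truncPow τ (z - w) * f w) := by
      intro w
      by_cases h : w ∈ ball z τ
      · rw [hfz, indicator_of_mem h, truncPow, indicator_of_mem (by rwa [← hmem])]; ring
      · rw [hfz, indicator_of_notMem h, truncPow, indicator_of_notMem (by rwa [← hmem])]; ring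
    have hJ := exp_integral_mul_le (f := fz) (φ := fun w => truncLog τ (z - w)) (κ := 3 / 2)
      (by norm_num) (fun w => indicator_nonneg (fun w _ => by have := h0 w; positivity) _)
      ((hf.integrable.const_mul _).indicator measurableSet_ball)
      (by simp_rw [e1]; exact (hlogint z).const_mul _)
      (by simp_rw [e2]; exact (hpowint z).const_mul _)
      (by
        rw [hfz, integral_indicator measurableSet_ball, integral_const_mul]
        have := hYm z hz
        have h3 : 0 ≤ ∫ w in ball z τ, f w := integral_nonneg h0
        nlinarith)
    simp_rw [e1, e2, integral_const_mul] at hJ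
    refine hJ.trans ?_
    have h4 : 0 ≤ ∫ w, truncPow τ (z - w) * f w :=
      integral_nonneg fun w => mul_nonneg (truncPow_nonneg _ _) (h0 w)
    nlinarith
  have hYfin : volume Y ≠ ∞ := ((measure_mono hYc).trans_lt measure_ball_lt_top).ne
  obtain ⟨hci, hcint⟩ := integrable_convolution_truncPow hf hτ
  replace hcint : ∫ z, ∫ w, truncPow τ (z - w) * f w = M * (π * t ^ 2) := by
    rw [hcint, hτdef]; ring
  have hcnn : ∀ z, 0 ≤ ∫ w, truncPow τ (z - w) * f w := fun z =>
    integral_nonneg fun w => mul_nonneg (truncPow_nonneg _ _) (h0 w)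
  set E := exp ((1 + ε) * ringPot f c t) with hE
  have h5 : exp ((1 + ε) * (M * log 5)) ≤ 125 := by
    have h53 : (125 : ℝ) = exp (3 * log 5) := by
      rw [← exp_log (show (0:ℝ) < 125 by norm_num), exp_eq_exp,
        show (125:ℝ) = 5 ^ 3 by norm_num, log_pow]; norm_num
    rw [h53, exp_le_exp]
    have : 0 < log 5 := log_pos (by norm_num)
    nlinarith [mul_nonneg hM0 this.le, mul_le_mul_of_nonneg_right hM this.le]
  have hbound : ∀ z ∈ Y, exp ((1 + ε) * logPot f z) ≤
      125 * E * (1 + 3 / 4 * ∫ w, truncPow τ (z - w) * f w) := by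
    intro z hz
    calc exp ((1 + ε) * logPot f z)
        ≤ exp ((1 + ε) * (ringPot f c t + M * log 5 + ∫ w, truncLog τ (z - w) * f w)) := by
          gcongr; exact hpt z hz
      _ = exp ((1 + ε) * (M * log 5)) * E * exp ((1 + ε) * ∫ w, truncLog τ (z - w) * f w) := by
          rw [hE, ← exp_add, ← exp_add]; ring_nf
      _ ≤ _ := by
          gcongr
          exact hnear z hz
  have hInt : IntegrableOn (fun z => 125 * E * (1 + 3 / 4 * ∫ w, truncPow τ (z - w) * f w)) Y :=
    ((integrableOn_const hYfin).add (hci.integrableOn.const_mul _)).const_mul _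
  calc ∫ z in Y, exp ((1 + ε) * logPot f z)
      ≤ ∫ z in Y, 125 * E * (1 + 3 / 4 * ∫ w, truncPow τ (z - w) * f w) :=
        setIntegral_mono_on ((hf.integrableOn_exp_logPot _ c (2 * t)).mono_set hYc) hInt hY hbound
    _ = 125 * E * (volume.real Y + 3 / 4 * ∫ z in Y, ∫ w, truncPow τ (z - w) * f w) := by
        have i1 : IntegrableOn (fun _ : ℂ => (1 : ℝ)) Y := integrableOn_const hYfin
        rw [integral_const_mul, integral_add i1 (hci.integrableOn.const_mul _),
          integral_const_mul]
        simp
    _ ≤ 125 * E * (4 * π * t ^ 2 + 3 / 4 * (M * (π * t ^ 2))) := by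
        gcongr
        · refine (measureReal_mono hYc measure_ball_lt_top.ne).trans ?_
          rw [volume_real_ball c (by positivity)]
          apply le_of_eq; ring
        · rw [← hcint]
          exact setIntegral_le_integral hci (.of_forall hcnn)
    _ ≤ 125 * E * (4 * π * t ^ 2 + 3 / 4 * (2 * (π * t ^ 2))) := by gcongr
    _ ≤ _ := by
        have : 0 ≤ E * (π * t ^ 2) := by positivity
        nlinarith

/-- A geometric weight `x ^ (K - j)` does not change the size of the sum of a sequence growing at
least like `x ^ (2 * j)`. -/
theorem sum_pow_mul_le_two_mul_sum {b : ℕ → ℝ} {x : ℝ} (hx : 1 < x) (hb : ∀ j, 0 ≤ b j) (K : ℕ)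
    (hgrow : ∀ j < K, x ^ 2 * b j ≤ b (j + 1)) :
    ∑ j ∈ Finset.range (K + 1), x ^ (K - j) * b j ≤ 2 * ∑ j ∈ Finset.range (K + 1), b j := by
  have hS : ∀ n ≤ K, (x ^ 2 - 1) * ∑ j ∈ Finset.range (n + 1), b j ≤ x ^ 2 * b n := by
    intro n
    induction n with
    | zero => intro _; simp; nlinarith [hb 0]
    | succ n ih =>
      intro hn
      have h1 := ih (by omega)
      have h2 := hgrow n (by omega)
      rw [Finset.sum_range_succ]
      nlinarith
  have hT : ∀ n ≤ K, ∑ j ∈ Finset.range (n + 1), x ^ (n - j) * b j ≤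
      2 * ∑ j ∈ Finset.range (n + 1), b j := by
    intro n
    induction n with
    | zero => intro _; simp; linarith [hb 0]
    | succ n ih =>
      intro hn
      have h1 := ih (by omega)
      have h2 := hgrow n (by omega)
      have h3 := hS n (by omega)
      have e : ∑ j ∈ Finset.range (n + 1), x ^ (n + 1 - j) * b j =
          x * ∑ j ∈ Finset.range (n + 1), x ^ (n - j) * b j := by
        rw [Finset.mul_sum]
        refine Finset.sum_congr rfl fun j hj => ?_
        have : n + 1 - j = (n - j) + 1 := by have := Finset.mem_range.1 hj; omega
        rw [this, pow_succ]; ring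
      rw [Finset.sum_range_succ, Finset.sum_range_succ _ (n + 1), e]
      simp only [Nat.sub_self, pow_zero, one_mul]
      set S := ∑ j ∈ Finset.range (n + 1), b j
      have hS0 : 0 ≤ S := Finset.sum_nonneg fun j _ => hb j
      have h4 : (x - 1) * (2 * S) ≤ b (n + 1) := by
        have : (x - 1) * (2 * S) ≤ (x ^ 2 - 1) * S := by
          nlinarith [mul_nonneg (sub_nonneg.2 hx.le) (mul_nonneg (sub_nonneg.2 hx.le) hS0)]
        linarith
      nlinarith
  exact hT K le_rfl

section localEstimate

variable {f : ℂ → ℝ}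

theorem IsTame.exists_mass_lt (hf : IsTame f) {m : ℝ} (hm : 0 < m) {s : ℝ} (hs : 0 < s) :
    ∃ K : ℕ, ∀ z, ∫ w in ball z (s / 2 ^ (K + 1)), f w < m := by
  obtain ⟨B, ρ, hB, hρ, hfB, -⟩ := hf.exists_bound
  have hlim : Filter.Tendsto (fun K : ℕ => B * (π * (s * (1 / 2 : ℝ) ^ (K + 1)) ^ 2)) Filter.atTop
      (nhds (B * (π * (s * 0) ^ 2))) := by
    have h := (tendsto_pow_atTop_nhds_zero_of_lt_one (r := (1 / 2 : ℝ)) (by norm_num)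
      (by norm_num)).comp (Filter.tendsto_add_atTop_nat 1)
    exact (((h.const_mul s).pow 2).const_mul π).const_mul B
  obtain ⟨K, hK⟩ := (hlim.eventually_lt_const (u := m) (by simpa using hm)).exists
  refine ⟨K, fun z => lt_of_le_of_lt ?_ hK⟩
  have e : s / 2 ^ (K + 1) = s * (1 / 2 : ℝ) ^ (K + 1) := by
    rw [one_div, inv_pow, div_eq_mul_inv]
  calc ∫ w in ball z (s / 2 ^ (K + 1)), f w
      ≤ ∫ w in ball z (s / 2 ^ (K + 1)), B :=
        setIntegral_mono hf.integrable.integrableOn (integrableOn_const measure_ball_lt_top.ne)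
          fun w => (le_abs_self _).trans (hfB w)
    _ = _ := by
        rw [setIntegral_const, volume_real_ball z (by positivity), e, smul_eq_mul, mul_comm]

/-- The largest dyadic scale below `s` at which no point of `ball a s` carries mass `4 / 3`. -/
theorem IsTame.exists_heavy_center (hf : IsTame f) (a : ℂ) {s : ℝ} (hs : 0 < s) :
    ∃ (K : ℕ), ∃ c ∈ ball a s, (K ≠ 0 → 4 / 3 ≤ ∫ w in ball c (s / 2 ^ K), f w) ∧
      ∀ z ∈ ball a s, ∫ w in ball z (s / 2 ^ (K + 1)), f w ≤ 4 / 3 := by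
  classical
  have hex : ∃ K : ℕ, ∀ z ∈ ball a s, ∫ w in ball z (s / 2 ^ (K + 1)), f w < 4 / 3 := by
    obtain ⟨K, hK⟩ := hf.exists_mass_lt (m := 4 / 3) (by norm_num) hs
    exact ⟨K, fun z _ => hK z⟩
  have hspec := Nat.find_spec hex
  rcases hK : Nat.find hex with _ | k
  · rw [hK] at hspec
    exact ⟨0, a, mem_ball_self hs, fun h => absurd rfl h, fun z hz => (hspec z hz).le⟩
  · rw [hK] at hspec
    have hmin := Nat.find_min hex (m := k) (by omega)
    push Not at hmin
    obtain ⟨c, hc, hcm⟩ := hmin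
    exact ⟨k + 1, c, hc, fun _ => hcm, fun z hz => (hspec z hz).le⟩

theorem dyadic_upper (hf : IsTame f) (h0 : ∀ w, 0 ≤ f w) (hM : ∫ w, f w ≤ 2) {ε r : ℝ}
    (hε : 0 ≤ ε) (hε' : ε ≤ 1 / 8) (hr : 0 < r) {c : ℂ} {S : Set ℂ} (hS : MeasurableSet S)
    (n : ℕ) (hn : n ≠ 0 → 4 / 3 ≤ ∫ w in ball c r, f w)
    (hS0 : ∀ z ∈ S, ∫ w in ball z (r / 2), f w ≤ 4 / 3) :
    ∫ z in S ∩ ball c (2 * (2 ^ n * r)), exp ((1 + ε) * logPot f z) ≤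
      ∑ j ∈ Finset.range (n + 1), 750 * π * (2 ^ j * r) ^ 2 *
        exp ((1 + ε) * ringPot f c (2 ^ j * r)) := by
  induction n with
  | zero =>
    simp only [pow_zero, one_mul, zero_add, Finset.sum_range_one]
    exact setIntegral_exp_logPot_le hf h0 hM hε hε' hr (hS.inter measurableSet_ball)
      inter_subset_right fun z hz => hS0 z hz.1
  | succ n ih =>
    have hheavy := hn (by simp)
    have ih' := ih fun _ => hheavy
    set t := 2 ^ (n + 1) * r with ht
    have ht0 : 0 < t := by positivity
    have ht2 : 2 * (2 ^ n * r) = t := by rw [ht, pow_succ]; ring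
    have htr : 2 * r ≤ t := by
      rw [← ht2]
      have : (1 : ℝ) ≤ 2 ^ n := one_le_pow₀ (by norm_num)
      nlinarith
    have hYm : MeasurableSet (S ∩ annulus c t (2 * t)) := hS.inter (measurableSet_annulus _ _ _)
    have hYsub : S ∩ annulus c t (2 * t) ⊆ ball c (2 * t) :=
      inter_subset_right.trans (annulus_subset_ball _ _ _)
    have hunion : S ∩ ball c (2 * t) = (S ∩ ball c t) ∪ (S ∩ annulus c t (2 * t)) := by
      ext z
      simp only [mem_inter_iff, mem_union, mem_ball, dist_eq_norm, annulus, mem_ofPred_eq]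
      constructor
      · rintro ⟨h1, h2⟩
        rcases lt_or_ge ‖z - c‖ t with h | h
        · exact .inl ⟨h1, h⟩
        · exact .inr ⟨h1, h, h2⟩
      · rintro (⟨h1, h2⟩ | ⟨h1, -, h2⟩)
        · exact ⟨h1, by linarith⟩
        · exact ⟨h1, h2⟩
    have hdisj : Disjoint (S ∩ ball c t) (S ∩ annulus c t (2 * t)) := by
      refine Set.disjoint_left.2 fun z hz hz' => ?_
      have h1 := hz.2
      rw [mem_ball, dist_eq_norm] at h1
      exact absurd hz'.2.1 (not_le.2 h1)
    have hInt := hf.integrableOn_exp_logPot (1 + ε) c (2 * t)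
    rw [hunion, setIntegral_union hdisj hYm
      (hInt.mono_set (inter_subset_right.trans (ball_subset_ball (by linarith))))
      (hInt.mono_set hYsub), Finset.sum_range_succ]
    rw [ht2] at ih'
    refine add_le_add ih' (setIntegral_exp_logPot_le hf h0 hM hε hε' ht0 hYm hYsub fun z hz => ?_)
    have hdb : Disjoint (ball z (t / 2)) (ball c r) := by
      refine ball_disjoint_ball ?_
      rw [dist_eq_norm]
      have := hz.2.1
      linarith
    have h1 : ∫ w in ball z (t / 2) ∪ ball c r, f w ≤ ∫ w, f w :=
      setIntegral_le_integral hf.integrable (.of_forall h0)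
    rw [setIntegral_union hdb measurableSet_ball hf.integrable.integrableOn
      hf.integrable.integrableOn] at h1
    linarith

theorem dyadic_lower (hf : IsTame f) (h0 : ∀ w, 0 ≤ f w) {r : ℝ} (hr : 0 < r) (c : ℂ) (n : ℕ) :
    ∑ j ∈ Finset.range (n + 1), 3 / 4 * π * (2 ^ j * r) ^ 2 * exp (ringPot f c (2 ^ j * r)) ≤
      ∫ z in ball c (2 ^ n * r), exp (logPot f z) := by
  have hInt : ∀ t, IntegrableOn (fun z => exp (logPot f z)) (ball c t) := fun t => by
    simpa using hf.integrableOn_exp_logPot 1 c t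
  induction n with
  | zero =>
    simp only [pow_zero, one_mul, zero_add, Finset.sum_range_one]
    refine (area_mul_exp_ringPot_le hf (fun w _ => h0 w) hr).trans ?_
    exact setIntegral_mono_set (hInt r) (.of_forall fun z => (exp_pos _).le)
      (annulus_subset_ball _ _ _).eventuallyLE
  | succ n ih =>
    set t := 2 ^ (n + 1) * r with ht
    have ht0 : 0 < t := by positivity
    have ht2 : 2 ^ n * r = t / 2 := by rw [ht, pow_succ]; ring
    have hdisj : Disjoint (ball c (t / 2)) (annulus c (t / 2) t) := by
      refine Set.disjoint_left.2 fun z hz hz' => ?_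
      rw [mem_ball, dist_eq_norm] at hz
      exact absurd hz'.1 (not_le.2 hz)
    rw [Finset.sum_range_succ]
    have h1 := area_mul_exp_ringPot_le hf (c := c) (fun w _ => h0 w) ht0
    rw [ht2] at ih
    refine (add_le_add ih h1).trans ?_
    rw [← setIntegral_union hdisj (measurableSet_annulus _ _ _) (hInt _)
      ((hInt t).mono_set (annulus_subset_ball _ _ _))]
    refine setIntegral_mono_set (hInt t) (.of_forall fun z => (exp_pos _).le) ?_
    exact (union_subset (ball_subset_ball (by linarith))
      (annulus_subset_ball _ _ _)).eventuallyLE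

/-- Self-improvement of exponential integrability for a positive measure of mass below `2`,
at the scale of its support. -/
theorem local_estimate (hf : IsTame f) (h0 : ∀ w, 0 ≤ f w) {a : ℂ} {s η ε : ℝ} (hs : 0 < s)
    (hη : 0 < η) (hM : ∫ w, f w ≤ 2 - η)
    (hε : 0 ≤ ε) (hε8 : ε ≤ 1 / 8) (hεη : ε ≤ η / 4) :
    ∫ z in ball a s, exp ((1 + ε) * (logPot f z + (∫ w, f w) * log (8 * s))) ≤
      128000 * ∫ z in ball a (2 * s), exp (logPot f z + (∫ w, f w) * log (8 * s)) := by
  obtain ⟨K, c, hc, hheavy, hlight⟩ := hf.exists_heavy_center a hs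
  set M := ∫ w, f w with hMdef
  have hM0 : 0 ≤ M := integral_nonneg h0
  set r := s / 2 ^ K with hrdef
  have hr : 0 < r := by positivity
  have hKr : 2 ^ K * r = s := by rw [hrdef]; field_simp
  have hr2 : s / 2 ^ (K + 1) = r / 2 := by rw [hrdef, pow_succ]; field_simp
  rw [hr2] at hlight
  have hca : dist c a < s := hc
  set L := M * log (8 * s) with hL
  set Q : ℕ → ℝ := fun j => ringPot f c (2 ^ j * r) + L with hQ
  set b : ℕ → ℝ := fun j => (2 ^ j * r) ^ 2 * exp (Q j) with hb
  have hl2 : 0 < log 2 := log_pos one_lt_two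
  -- the circle mean at the top scale
  have hQK : Q K ≤ 2 * log 8 := by
    have i1 := hf.integrable_neg_log_max_mul c s
    have i2 : Integrable fun w => f w * log (8 * s) := hf.integrable.mul_const _
    simp only [hQ, hKr, hL]
    have : ringPot f c s + M * log (8 * s) ≤ M * log 8 := by
      rw [ringPot, hMdef, ← integral_mul_const, ← integral_add i1 i2, ← integral_mul_const]
      refine integral_mono (i1.add i2) (hf.integrable.mul_const _) fun w => ?_
      simp only
      rw [log_mul (by norm_num) hs.ne']
      have := log_le_log hs (le_max_left s ‖w - c‖)
      nlinarith [mul_nonneg (h0 w) (sub_nonneg.2 this)]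
    have h8 : 0 < log 8 := log_pos (by norm_num)
    nlinarith
  -- consecutive scales
  have hstep : ∀ j, Q j ≤ Q (j + 1) + (2 - η) * log 2 := by
    intro j
    have h := ringPot_sub_le hf (c := c) (r := 2 ^ j * r) (r' := 2 ^ (j + 1) * r)
      (fun w _ => h0 w) (by positivity) (by gcongr <;> norm_num)
    have e : 2 ^ (j + 1) * r / (2 ^ j * r) = 2 := by field_simp; ring
    rw [e] at h
    have h2 : ∫ w in ball c (2 ^ (j + 1) * r), f w ≤ M :=
      setIntegral_le_integral hf.integrable (.of_forall h0)
    simp only [hQ]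
    nlinarith
  have hQj : ∀ i ≤ K, Q (K - i) ≤ 2 * log 8 + i * (2 * log 2) := by
    intro i
    induction i with
    | zero => intro _; simpa using hQK
    | succ i ih =>
      intro hi
      have h1 := ih (by omega)
      have h2 := hstep (K - (i + 1))
      have e : K - (i + 1) + 1 = K - i := by omega
      rw [e] at h2
      push_cast
      nlinarith
  set x := exp (η / 2 * log 2) with hx
  have hx1 : 1 < x := by rw [hx]; exact one_lt_exp_iff.2 (by positivity)
  have hgrow : ∀ j < K, x ^ 2 * b j ≤ b (j + 1) := by
    intro j _
    have e4 : exp (2 * log 2) = 4 := by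
      rw [mul_comm, exp_mul, exp_log two_pos]; norm_num
    have h1 : x ^ 2 * exp (Q j) ≤ 4 * exp (Q (j + 1)) := by
      rw [← e4, hx, ← exp_nat_mul, ← exp_add, ← exp_add, exp_le_exp]
      have := hstep j
      push_cast
      linarith
    simp only [hb]
    calc x ^ 2 * ((2 ^ j * r) ^ 2 * exp (Q j)) = (2 ^ j * r) ^ 2 * (x ^ 2 * exp (Q j)) := by ring
      _ ≤ (2 ^ j * r) ^ 2 * (4 * exp (Q (j + 1))) := by gcongr
      _ = _ := by rw [pow_succ]; ring
  have hweight : ∀ j ∈ Finset.range (K + 1), exp (ε * Q j) ≤ 64 * x ^ (K - j) := by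
    intro j hj
    have hjK : j ≤ K := by have := Finset.mem_range.1 hj; omega
    have h1 := hQj (K - j) (by omega)
    rw [Nat.sub_sub_self hjK] at h1
    have e64 : (64 : ℝ) = exp (2 * log 8) := by
      rw [mul_comm, exp_mul, exp_log (by norm_num)]; norm_num
    rw [e64, hx, ← exp_nat_mul, ← exp_add, exp_le_exp]
    have h8 : 0 < log 8 := log_pos (by norm_num)
    set k : ℝ := ((K - j : ℕ) : ℝ)
    have hk : 0 ≤ k := Nat.cast_nonneg _
    calc ε * Q j ≤ ε * (2 * log 8 + k * (2 * log 2)) := by gcongr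
      _ = ε * (2 * log 8) + ε * (k * (2 * log 2)) := by ring
      _ ≤ 1 * (2 * log 8) + η / 4 * (k * (2 * log 2)) := by gcongr; linarith
      _ = _ := by ring
  have hsub1 : ball a s ⊆ ball a s ∩ ball c (2 * (2 ^ K * r)) := by
    refine subset_inter subset_rfl fun z hz => ?_
    rw [hKr, mem_ball]
    rw [mem_ball] at hz
    have := dist_triangle_right z c a
    linarith
  have hsub2 : ball c (2 ^ K * r) ⊆ ball a (2 * s) := by
    intro z hz
    rw [hKr, mem_ball] at hz
    rw [mem_ball]
    have := dist_triangle z c a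
    linarith
  have hup := dyadic_upper hf h0 (by linarith) hε hε8 hr (measurableSet_ball (x := a) (ε := s)) K
    hheavy hlight
  rw [← hsub1.antisymm inter_subset_left] at hup
  have hlow := dyadic_lower hf h0 hr c K
  have hInt : IntegrableOn (fun z => exp (logPot f z)) (ball a (2 * s)) := by
    simpa using hf.integrableOn_exp_logPot 1 a (2 * s)
  have hlow' := hlow.trans (setIntegral_mono_set hInt (.of_forall fun z => (exp_pos _).le)
    hsub2.eventuallyLE)
  have hbnn : ∀ j, 0 ≤ b j := fun j => by simp only [hb]; positivity
  have hsum := sum_pow_mul_le_two_mul_sum hx1 hbnn K hgrow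
  have e1 : ∫ z in ball a s, exp ((1 + ε) * (logPot f z + L)) =
      exp ((1 + ε) * L) * ∫ z in ball a s, exp ((1 + ε) * logPot f z) := by
    rw [← integral_const_mul]
    congr 1; ext z; rw [← exp_add]; ring_nf
  have e2 : ∫ z in ball a (2 * s), exp (logPot f z + L) =
      exp L * ∫ z in ball a (2 * s), exp (logPot f z) := by
    rw [← integral_const_mul]
    congr 1; ext z; rw [← exp_add]; ring_nf
  have hupL : exp ((1 + ε) * L) * ∑ j ∈ Finset.range (K + 1), 750 * π * (2 ^ j * r) ^ 2 *
        exp ((1 + ε) * ringPot f c (2 ^ j * r)) ≤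
      48000 * π * ∑ j ∈ Finset.range (K + 1), x ^ (K - j) * b j := by
    rw [Finset.mul_sum, Finset.mul_sum]
    refine Finset.sum_le_sum fun j hj => ?_
    calc _ = 750 * π * b j * exp (ε * Q j) := by
          simp only [hb, hQ]
          have : exp ((1 + ε) * L) * exp ((1 + ε) * ringPot f c (2 ^ j * r)) =
              exp (ringPot f c (2 ^ j * r) + L) * exp (ε * (ringPot f c (2 ^ j * r) + L)) := by
            rw [← exp_add, ← exp_add]; ring_nf
          linear_combination (750 * π * (2 ^ j * r) ^ 2) * this
      _ ≤ 750 * π * b j * (64 * x ^ (K - j)) := by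
          have := hbnn j
          gcongr
          exact hweight j hj
      _ = _ := by ring
  have hlowL : 3 / 4 * π * ∑ j ∈ Finset.range (K + 1), b j ≤
      exp L * ∫ z in ball a (2 * s), exp (logPot f z) := by
    refine le_trans (le_of_eq ?_) (mul_le_mul_of_nonneg_left hlow' (exp_pos L).le)
    rw [Finset.mul_sum, Finset.mul_sum]
    refine Finset.sum_congr rfl fun j _ => ?_
    simp only [hb, hQ, exp_add]
    ring
  rw [e1, e2]
  calc _ ≤ _ := mul_le_mul_of_nonneg_left hup (exp_pos _).le
    _ ≤ _ := hupL
    _ ≤ 48000 * π * (2 * ∑ j ∈ Finset.range (K + 1), b j) := by gcongr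
    _ = 128000 * (3 / 4 * π * ∑ j ∈ Finset.range (K + 1), b j) := by ring
    _ ≤ _ := by gcongr

end localEstimate

theorem logPot_add {f g : ℂ → ℝ} (hf : IsTame f) (hg : IsTame g) (z : ℂ) :
    logPot (fun w => f w + g w) z = logPot f z + logPot g z := by
  simp only [logPot, mul_add]
  exact integral_add (hf.integrable_neg_log_mul z) (hg.integrable_neg_log_mul z)

section center

variable {f : ℂ → ℝ} {a : ℂ} {A : ℝ}

theorem ringPot_eighth_nonneg (hf : IsTame f) (h0 : ∀ w ∈ ball a (1 / 4), 0 ≤ f w)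
    (hU : ∀ z ∈ ball a (1 / 4), 0 ≤ logPot f z) : 0 ≤ ringPot f a (1 / 8) := by
  set ψ : ℝ → ℝ := (Ico (1 / 8) (1 / 4)).indicator 1 with hψ
  have hψm : Measurable ψ := measurable_one.indicator measurableSet_Ico
  have hann : ∀ z, ‖z - a‖ ∈ Ico (1 / 8 : ℝ) (1 / 4) → z ∈ ball a (1 / 4) := fun z hz => by
    simpa [mem_ball, dist_eq_norm] using hz.2
  have hψt : IsTame fun z => ψ ‖z - a‖ := by
    refine IsTame.of_bounded_on_ball (c := a) (t := 1 / 4) (B := 1) (by fun_prop)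
      (fun z _ => ?_) fun z hz => ?_
    · by_cases h : ‖z - a‖ ∈ Ico (1 / 8 : ℝ) (1 / 4) <;> simp only [hψ]
      · rw [indicator_of_mem h]; simp
      · rw [indicator_of_notMem h]; simp
    · simp only [hψ]
      rw [indicator_of_notMem]
      exact fun h => hz (hann z h)
  have key := integral_radial_mul_logPot hf hψt
  have h1 : 0 ≤ ∫ z, ψ ‖z - a‖ * logPot f z := by
    refine integral_nonneg fun z => ?_
    simp only [Pi.zero_apply, hψ]
    by_cases h : ‖z - a‖ ∈ Ico (1 / 8 : ℝ) (1 / 4)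
    · rw [indicator_of_mem h]; simpa using hU z (hann z h)
    · rw [indicator_of_notMem h]; simp
  by_contra hneg
  rw [not_le] at hneg
  rw [key] at h1
  have hle : ∀ z, ψ ‖z - a‖ * ringPot f a ‖z - a‖ ≤ ψ ‖z - a‖ * ringPot f a (1 / 8) := by
    intro z
    simp only [hψ]
    by_cases h : ‖z - a‖ ∈ Ico (1 / 8 : ℝ) (1 / 4)
    · rw [indicator_of_mem h]
      simp only [Pi.one_apply, one_mul]
      exact ringPot_anti hf (fun w hw => h0 w (ball_subset_ball h.2.le hw)) (by norm_num) h.1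
    · rw [indicator_of_notMem h]; simp
  have hmass : ∫ z, ψ ‖z - a‖ = π * ((1 / 4) ^ 2 - (1 / 8) ^ 2) := by
    rw [← volume_real_annulus a (by norm_num) (by norm_num), ← integral_indicator_one
      (measurableSet_annulus _ _ _)]
    rfl
  obtain ⟨B, hB⟩ := hf.abs_ringPot_le a (t₁ := 1 / 8) (t₂ := 1 / 4) (by norm_num)
  have hmQ := hf.measurable_ringPot a
  have hi : Integrable fun z => ψ ‖z - a‖ * ringPot f a ‖z - a‖ := by
    refine (hψt.integrable.mul_const B).mono' (Measurable.aestronglyMeasurable (by fun_prop))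
      (.of_forall fun z => ?_)
    simp only [hψ]
    by_cases h : ‖z - a‖ ∈ Ico (1 / 8 : ℝ) (1 / 4)
    · rw [indicator_of_mem h]
      simpa using hB _ h.1 h.2
    · rw [indicator_of_notMem h]; simp
  have h2 := integral_mono hi (hψt.integrable.mul_const (ringPot f a (1 / 8))) hle
  rw [integral_mul_const, hmass] at h2
  nlinarith [pi_pos, mul_pos pi_pos (neg_pos.2 hneg)]

theorem exp_ringPot_le (hf : IsTame f) (h0 : ∀ w ∈ ball a (1 / 4), 0 ≤ f w)
    (hInt : ∫ z in ball a (1 / 4), exp (logPot f z) ≤ A) {r : ℝ} (hr : 0 < r) (hr' : r ≤ 1 / 4) :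
    exp (ringPot f a r) ≤ A / (2 * r ^ 2) := by
  have h1 := area_mul_exp_ringPot_le hf (c := a) (r := r)
    (fun w hw => h0 w (ball_subset_ball hr' hw)) hr
  have hi : IntegrableOn (fun z => exp (logPot f z)) (ball a (1 / 4)) := by
    simpa using hf.integrableOn_exp_logPot 1 a (1 / 4)
  have h2 := h1.trans ((setIntegral_mono_set hi (.of_forall fun z => (exp_pos _).le)
    ((annulus_subset_ball a (r / 2) r).trans (ball_subset_ball hr')).eventuallyLE).trans hInt)
  rw [le_div_iff₀ (by positivity)]
  have : 0 < r ^ 2 * exp (ringPot f a r) := by positivity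
  nlinarith [pi_gt_three]

theorem mass_sixteenth_le (hf : IsTame f) (h0 : ∀ w ∈ ball a (1 / 4), 0 ≤ f w)
    (hU : ∀ z ∈ ball a (1 / 4), 0 ≤ logPot f z)
    (hInt : ∫ z in ball a (1 / 4), exp (logPot f z) ≤ A) :
    ∫ w in ball a (1 / 16), f w ≤ 256 * A := by
  have h1 := mass_mul_log_le hf (c := a) (r := 1 / 16) (r' := 1 / 8)
    (fun w hw => h0 w (ball_subset_ball (by norm_num) hw)) (by norm_num) (by norm_num)
  have h2 := ringPot_eighth_nonneg hf h0 hU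
  have h3 := exp_ringPot_le hf h0 hInt (r := 1 / 16) (by norm_num) (by norm_num)
  have h4 := add_one_le_exp (ringPot f a (1 / 16))
  have h5 : 0 ≤ ∫ w in ball a (1 / 16), f w :=
    setIntegral_nonneg measurableSet_ball fun w hw => h0 w (ball_subset_ball (by norm_num) hw)
  norm_num at h1 h3
  nlinarith [log_two_gt_d9]

theorem integral_annulus_inv_sq (a : ℂ) {r₀ r₁ : ℝ} (h0 : 0 < r₀) (h1 : r₀ ≤ r₁) :
    ∫ z in annulus a r₀ r₁, (‖z - a‖ ^ 2)⁻¹ = 2 * π * log (r₁ / r₀) := by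
  have e : (annulus a r₀ r₁).indicator (fun z => (‖z - a‖ ^ 2)⁻¹) =
      fun z => (Ico r₀ r₁).indicator (fun r => (r ^ 2)⁻¹) ‖z - a‖ := rfl
  rw [← integral_indicator (measurableSet_annulus _ _ _), e,
    integral_sub_right_eq_self (fun y => (Ico r₀ r₁).indicator (fun r => (r ^ 2)⁻¹) ‖y‖) a,
    integral_fun_norm_addHaar volume fun x => (Ico r₀ r₁).indicator (fun r => (r ^ 2)⁻¹) x]
  have e2 : ∀ y ∈ Ioi (0 : ℝ), y ^ (Module.finrank ℝ ℂ - 1) •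
      (Ico r₀ r₁).indicator (fun r => (r ^ 2)⁻¹) y = (Ico r₀ r₁).indicator (fun r => r⁻¹) y := by
    intro y hy
    have hy0 : (0 : ℝ) < y := hy
    by_cases h : y ∈ Ico r₀ r₁
    · simp only [indicator_of_mem h, Complex.finrank_real_complex, smul_eq_mul]
      norm_num
      field_simp
    · simp only [indicator_of_notMem h, smul_zero]
  rw [setIntegral_congr_fun measurableSet_Ioi e2, integral_indicator measurableSet_Ico,
    Measure.restrict_restrict measurableSet_Ico,
    inter_eq_left.2 (show Ico r₀ r₁ ⊆ Ioi 0 from fun y hy => h0.trans_le hy.1),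
    integral_Ico_eq_integral_Ioc,
    ← intervalIntegral.integral_of_le h1, integral_inv_of_pos h0 (h0.trans_le h1),
    volume_real_ball 0 zero_le_one, Complex.finrank_real_complex]
  simp
  ring

/-- At an exponentially small scale the mass is definitely below the critical value `2`. -/
theorem mass_core_le (hf : IsTame f) (h0 : ∀ w ∈ ball a (1 / 4), 0 ≤ f w)
    (hU : ∀ z ∈ ball a (1 / 4), 0 ≤ logPot f z) (hA : 1 ≤ A)
    (hInt : ∫ z in ball a (1 / 4), exp (logPot f z) ≤ A) :
    ∫ w in ball a (exp (-(32 * A)) / 8), f w ≤ 2 - 1 / (32 * A) := by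
  by_contra hcon
  rw [not_le] at hcon
  set r₀ := exp (-(32 * A)) / 8 with hr₀
  set η := 1 / (32 * A) with hη
  have hη0 : 0 < η := by positivity
  have hηA : η * (32 * A) = 1 := by rw [hη]; field_simp
  have hr0 : 0 < r₀ := by positivity
  have hr1 : r₀ ≤ 1 / 8 := by
    have : exp (-(32 * A)) ≤ 1 := exp_le_one_iff.2 (by linarith)
    rw [hr₀]; linarith
  have hlogr₀ : log (8 * r₀) = -(32 * A) := by
    rw [hr₀, mul_div_cancel₀ _ (by norm_num), log_exp]
  have hlow : ∀ z ∈ annulus a r₀ (1 / 8), exp (-1) / 64 * (‖z - a‖ ^ 2)⁻¹ ≤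
      exp (ringPot f a ‖z - a‖) := by
    intro z hz
    set r := ‖z - a‖
    have hr : 0 < r := hr0.trans_le hz.1
    have h1 := mass_mul_log_le hf (c := a) (r := r) (r' := 1 / 8)
      (fun w hw => h0 w (ball_subset_ball (by norm_num) hw)) hr hz.2.le
    have h2 := ringPot_eighth_nonneg hf h0 hU
    have h3 : ∫ w in ball a r₀, f w ≤ ∫ w in ball a r, f w := by
      refine setIntegral_mono_set hf.integrable.integrableOn ?_
        (ball_subset_ball hz.1).eventuallyLE
      filter_upwards [ae_restrict_mem measurableSet_ball] with w hw
      exact h0 w (ball_subset_ball (by linarith [hz.2]) hw)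
    have e1 : log (1 / 8 / r) = -log (8 * r) := by rw [← log_inv]; congr 1; field_simp
    have h4 : log (8 * r) ≤ 0 := log_nonpos (by positivity) (by linarith [hz.2])
    have h5 : log (8 * r₀) ≤ log (8 * r) := log_le_log (by positivity) (by linarith [hz.1])
    rw [hlogr₀] at h5
    rw [e1] at h1
    have h6 : -1 - 2 * log (8 * r) ≤ ringPot f a r := by
      have : (2 - η) * -log (8 * r) ≤ (∫ w in ball a r, f w) * -log (8 * r) :=
        mul_le_mul_of_nonneg_right (by linarith) (by linarith)
      nlinarith
    calc exp (-1) / 64 * (r ^ 2)⁻¹ = exp (-1 - 2 * log (8 * r)) := by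
          rw [exp_sub, mul_comm 2, exp_mul, exp_log (by positivity)]
          norm_num
          field_simp
          norm_num
      _ ≤ _ := exp_le_exp.2 h6
  have hi : IntegrableOn (fun z => exp (logPot f z)) (ball a (1 / 4)) := by
    simpa using hf.integrableOn_exp_logPot 1 a (1 / 4)
  obtain ⟨B, hB⟩ := hf.abs_ringPot_le a (t₂ := 1 / 8) hr0
  have hmQ := hf.measurable_ringPot a
  have hiQ : IntegrableOn (fun z => exp (ringPot f a ‖z - a‖)) (annulus a r₀ (1 / 8)) := by
    refine Measure.integrableOn_of_bounded (M := exp B) (volume_annulus_ne_top _ _ _)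
      (Measurable.aestronglyMeasurable (by fun_prop)) ?_
    filter_upwards [ae_restrict_mem (measurableSet_annulus a r₀ (1 / 8))] with z hz
    rw [norm_of_nonneg (exp_pos _).le, exp_le_exp]
    exact (le_abs_self _).trans (hB _ hz.1 hz.2)
  have hii : IntegrableOn (fun z => exp (-1) / 64 * (‖z - a‖ ^ 2)⁻¹) (annulus a r₀ (1 / 8)) := by
    refine hiQ.mono' (Measurable.aestronglyMeasurable (by fun_prop)) ?_
    filter_upwards [ae_restrict_mem (measurableSet_annulus a r₀ (1 / 8))] with z hz
    rw [norm_of_nonneg (by positivity)]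
    exact hlow z hz
  have h7 := setIntegral_mono_on hii hiQ (measurableSet_annulus _ _ _) hlow
  rw [integral_const_mul, integral_annulus_inv_sq a hr0 hr1] at h7
  have h8 := h7.trans ((integral_exp_ringPot_le hf a hr0).trans
    ((setIntegral_mono_set hi (.of_forall fun z => (exp_pos _).le)
      ((annulus_subset_ball a r₀ (1 / 8)).trans
        (ball_subset_ball (by norm_num))).eventuallyLE).trans hInt))
  have e1 : log (1 / 8 / r₀) = 32 * A := by
    rw [← neg_neg (32 * A), ← hlogr₀, ← log_inv]; congr 1; field_simp
  rw [e1] at h8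
  have h9 : exp (-1) * π ≤ 1 := by
    by_contra h
    rw [not_le] at h
    nlinarith
  have h10 : exp (-1) * exp 1 = 1 := by rw [← exp_add]; simp
  nlinarith [exp_one_lt_d9, pi_gt_three, exp_pos (-1)]

end center

theorem abs_log_sub_log_le {x y d : ℝ} (hd : |x - y| ≤ d) (hy : 0 < y) (hdy : 2 * d ≤ y) :
    |log x - log y| ≤ 2 * d / y := by
  have hd' := abs_le.1 hd
  have hx : 0 < x := by linarith
  have hd0 : 0 ≤ d := (abs_nonneg _).trans hd
  rw [abs_le]
  constructor
  · have h := log_le_sub_one_of_pos (div_pos hy hx)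
    rw [log_div hy.ne' hx.ne'] at h
    have : y / x - 1 ≤ 2 * d / y := by
      rw [div_sub_one hx.ne', div_le_div_iff₀ hx hy]
      nlinarith
    linarith
  · have h := log_le_sub_one_of_pos (div_pos hx hy)
    rw [log_div hx.ne' hy.ne'] at h
    have : x / y - 1 ≤ 2 * d / y := by
      rw [div_sub_one hy.ne', div_le_div_iff_of_pos_right hy]
      linarith
    linarith

/-- Oscillation of the potential of a positive measure away from its support. -/
theorem abs_logPot_sub_le {f : ℂ → ℝ} (hf : IsTame f) (h0 : ∀ w, 0 ≤ f w) {a z : ℂ} {s r₀ : ℝ}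
    (hs : 0 < s) (hsupp : ∀ w ∈ ball a (4 * s), f w = 0) (hr₀ : 4 * s ≤ r₀)
    (hz : ‖z - a‖ ≤ 2 * s) :
    |logPot f z - logPot f a| ≤ (∫ w in ball a r₀, f w) + 4 * s / r₀ * ∫ w, f w := by
  have hr0 : 0 < r₀ := by linarith
  have i1 := hf.integrable_neg_log_mul z
  have i2 := hf.integrable_neg_log_mul a
  have e : logPot f z - logPot f a =
      ∫ w, (-log ‖z - w‖ * f w - -log ‖a - w‖ * f w) := (integral_sub i1 i2).symm
  rw [e, ← integral_indicator measurableSet_ball, ← integral_const_mul,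
    ← integral_add (hf.integrable.indicator measurableSet_ball) (hf.integrable.const_mul _)]
  refine abs_integral_le_integral_abs.trans (integral_mono (i1.sub i2).abs
    ((hf.integrable.indicator measurableSet_ball).add (hf.integrable.const_mul _)) fun w => ?_)
  simp only
  have e2 : |-log ‖z - w‖ * f w - -log ‖a - w‖ * f w| = |log ‖z - w‖ - log ‖a - w‖| * f w := by
    rw [← abs_of_nonneg (h0 w), ← abs_mul, abs_of_nonneg (h0 w), ← abs_neg]; ring_nf
  rw [e2]
  by_cases hw : w ∈ ball a (4 * s)
  · simpa [hsupp w hw] using indicator_nonneg (fun w _ => h0 w) w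
  have hwa : 4 * s ≤ ‖a - w‖ := by
    rw [norm_sub_rev]; simpa [mem_ball, dist_eq_norm] using hw
  have hd : |‖z - w‖ - ‖a - w‖| ≤ 2 * s := by
    refine (abs_norm_sub_norm_le _ _).trans ?_
    rwa [sub_sub_sub_cancel_right]
  have hy : 0 < ‖a - w‖ := by linarith
  have hb := abs_log_sub_log_le hd hy (by linarith)
  have hfr : 0 ≤ 4 * s / r₀ * f w := mul_nonneg (by positivity) (h0 w)
  by_cases hw' : w ∈ ball a r₀
  · rw [indicator_of_mem hw']
    have : 2 * (2 * s) / ‖a - w‖ ≤ 1 := by rw [div_le_one hy]; linarith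
    nlinarith [h0 w]
  · rw [indicator_of_notMem hw', zero_add]
    have hwr : r₀ ≤ ‖a - w‖ := by
      rw [norm_sub_rev]; simpa [mem_ball, dist_eq_norm] using hw'
    have : 2 * (2 * s) / ‖a - w‖ ≤ 4 * s / r₀ := by
      rw [div_le_div_iff₀ hy hr0]; nlinarith
    exact mul_le_mul_of_nonneg_right (hb.trans this) (h0 w)

/-- The tent `max 0 (1 / 32 - r)`. -/
noncomputable def tent (r : ℝ) : ℝ := max 0 (1 / 32 - r)

theorem tent_nonneg (r : ℝ) : 0 ≤ tent r := le_max_left _ _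

theorem measurable_tent : Measurable tent := by unfold tent; fun_prop

theorem tent_eq_zero {r : ℝ} (hr : 1 / 32 ≤ r) : tent r = 0 := max_eq_left (by linarith)

theorem isTame_tent (c : ℂ) : IsTame fun z => tent ‖z - c‖ := by
  have := measurable_tent
  refine IsTame.of_bounded_on_ball (c := c) (t := 1 / 32) (B := 1 / 32) (by fun_prop)
    (fun z _ => ?_) fun z hz => tent_eq_zero (by simpa [mem_ball, dist_eq_norm] using hz)
  rw [abs_of_nonneg (tent_nonneg _)]
  exact max_le (by norm_num) (by linarith [norm_nonneg (z - c)])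

theorem abs_tent_sub_le (x y : ℝ) : |tent x - tent y| ≤ |x - y| := by
  have := abs_max_sub_max_le_max 0 (1 / 32 - x) 0 (1 / 32 - y)
  refine this.trans (max_le (by simp) ?_)
  rw [abs_sub_comm]; apply le_of_eq; congr 1; ring

theorem integral_tent_ge (c : ℂ) : 1 / 64 ^ 3 ≤ ∫ z, tent ‖z - c‖ := by
  have h1 : ∫ z in ball c (1 / 64), (1 / 64 : ℝ) ≤ ∫ z in ball c (1 / 64), tent ‖z - c‖ := by
    refine setIntegral_mono_on (integrableOn_const measure_ball_lt_top.ne)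
      (isTame_tent c).integrable.integrableOn measurableSet_ball fun z hz => ?_
    rw [mem_ball, dist_eq_norm] at hz
    exact le_max_of_le_right (by linarith)
  have h2 := setIntegral_le_integral (s := ball c (1 / 64)) (isTame_tent c).integrable
    (.of_forall fun z => tent_nonneg _)
  rw [setIntegral_const, volume_real_ball c (by norm_num), smul_eq_mul] at h1
  nlinarith [pi_gt_three]

theorem integral_tent_mul_logPot {g : ℂ → ℝ} (hg : IsTame g) {z : ℂ}
    (h0 : ∀ w ∈ ball z (1 / 32), g w = 0) :
    ∫ y, tent ‖y - z‖ * logPot g y = (∫ y, tent ‖y - z‖) * logPot g z := by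
  rw [integral_radial_mul_logPot hg (isTame_tent z), ← integral_mul_const]
  congr 1; ext y
  rcases le_or_gt (1 / 32) ‖y - z‖ with h | h
  · simp [tent_eq_zero h]
  · congr 1
    simp only [ringPot, logPot]
    congr 1; ext w
    by_cases hw : w ∈ ball z (1 / 32)
    · simp [h0 w hw]
    · rw [mem_ball, dist_eq_norm, not_lt] at hw
      rw [max_eq_right (by linarith), norm_sub_rev]

/-- Oscillation of a potential that is harmonic on `ball a (1 / 16)`. -/
theorem abs_logPot_sub_le_of_far {g : ℂ → ℝ} (hg : IsTame g) {a z : ℂ}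
    (h0 : ∀ w ∈ ball a (1 / 16), g w = 0) (hz : ‖z - a‖ ≤ 1 / 32) :
    |logPot g z - logPot g a| ≤
      ‖z - a‖ * 64 ^ 3 * ∫ y in ball a (1 / 16), |logPot g y| := by
  have hsub : ball z (1 / 32) ⊆ ball a (1 / 16) :=
    ball_subset_ball' (by rw [dist_eq_norm]; linarith)
  have hza := integral_tent_mul_logPot hg fun w hw => h0 w (hsub hw)
  have haa := integral_tent_mul_logPot hg (z := a)
    fun w hw => h0 w (ball_subset_ball (by norm_num) hw)
  have hκ : ∫ y, tent ‖y - z‖ = ∫ y, tent ‖y - a‖ := by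
    rw [integral_sub_right_eq_self (fun y => tent ‖y‖) z,
      integral_sub_right_eq_self (fun y => tent ‖y‖) a]
  have hκ0 := integral_tent_ge a
  rw [hκ] at hza
  set κ := ∫ y, tent ‖y - a‖ with hκdef
  obtain ⟨B, hB⟩ := hg.exists_abs_logPot_le (‖a‖ + 1)
  have hmU := hg.measurable_logPot
  have hgi : IntegrableOn (fun y => |logPot g y|) (ball a (1 / 16)) := by
    refine Measure.integrableOn_of_bounded (M := B) measure_ball_lt_top.ne
      (Measurable.aestronglyMeasurable (by fun_prop)) ?_
    filter_upwards [ae_restrict_mem measurableSet_ball] with y hy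
    rw [norm_eq_abs, abs_abs]
    rw [mem_ball, dist_eq_norm] at hy
    exact hB y (by have := norm_sub_norm_le y a; linarith)
  have hti : ∀ c, ball c (1 / 32) ⊆ ball a (1 / 16) →
      Integrable fun y => tent ‖y - c‖ * logPot g y := by
    intro c hc
    have := (isTame_tent c).measurable
    refine (((isTame_tent c).integrable).mul_const B).mono'
      (Measurable.aestronglyMeasurable (by fun_prop)) (.of_forall fun y => ?_)
    rw [norm_mul, norm_of_nonneg (tent_nonneg _)]
    by_cases hy : y ∈ ball c (1 / 32)
    · have hy' := hc hy
      rw [mem_ball, dist_eq_norm] at hy'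
      exact mul_le_mul_of_nonneg_left
        (hB y (by have := norm_sub_norm_le y a; linarith)) (tent_nonneg _)
    · rw [tent_eq_zero (by simpa [mem_ball, dist_eq_norm] using hy)]; simp
  have hia := hti a (ball_subset_ball (by norm_num))
  have hiz := hti z hsub
  have hdiff : |κ * (logPot g z - logPot g a)| ≤
      ‖z - a‖ * ∫ y in ball a (1 / 16), |logPot g y| := by
    rw [mul_sub, ← hza, ← haa, ← integral_sub hiz hia, ← integral_const_mul,
      ← integral_indicator measurableSet_ball]
    refine abs_integral_le_integral_abs.trans (integral_mono (hiz.sub hia).abs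
      ((integrable_indicator_iff measurableSet_ball).2 (hgi.const_mul _)) fun y => ?_)
    simp only
    by_cases hy : y ∈ ball a (1 / 16)
    · rw [indicator_of_mem hy, ← sub_mul, abs_mul]
      refine mul_le_mul_of_nonneg_right ((abs_tent_sub_le _ _).trans ?_) (abs_nonneg _)
      refine (abs_norm_sub_norm_le _ _).trans ?_
      rw [sub_sub_sub_cancel_left, norm_sub_rev]
    · rw [indicator_of_notMem hy]
      have h1 : y ∉ ball z (1 / 32) := fun h => hy (hsub h)
      have h2 : y ∉ ball a (1 / 32) := fun h => hy (ball_subset_ball (by norm_num) h)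
      rw [tent_eq_zero (by simpa [mem_ball, dist_eq_norm] using h1),
        tent_eq_zero (by simpa [mem_ball, dist_eq_norm] using h2)]
      simp
  rw [abs_mul, abs_of_pos (lt_of_lt_of_le (by norm_num) hκ0)] at hdiff
  have h1 : 1 / 64 ^ 3 * |logPot g z - logPot g a| ≤ κ * |logPot g z - logPot g a| :=
    mul_le_mul_of_nonneg_right hκ0 (abs_nonneg _)
  have h2 := h1.trans hdiff
  norm_num at h2 ⊢
  linarith

theorem integral_abs_logPot_far_le {f : ℂ → ℝ} {a : ℂ} {A : ℝ} (hf : IsTame f)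
    (h0 : ∀ w ∈ ball a (1 / 4), 0 ≤ f w) (hU : ∀ z ∈ ball a (1 / 4), 0 ≤ logPot f z)
    (hInt : ∫ z in ball a (1 / 4), exp (logPot f z) ≤ A) :
    ∫ z in ball a (1 / 16), |logPot ((ball a (1 / 16))ᶜ.indicator f) z| ≤ 4097 * A := by
  set F := (ball a (1 / 16)).indicator f with hF
  set G := (ball a (1 / 16))ᶜ.indicator f with hG
  have hFt : IsTame F := hf.indicator measurableSet_ball
  have hGt : IsTame G := hf.indicator measurableSet_ball.compl
  have hsplit : ∀ z, logPot f z = logPot F z + logPot G z := by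
    intro z
    rw [← logPot_add hFt hGt]
    congr 1; ext w
    exact (congrFun (indicator_self_add_compl (ball a (1 / 16)) f) w).symm
  have hsub : ball a (1 / 16 : ℝ) ⊆ ball a (1 / 4) := ball_subset_ball (by norm_num)
  have hF0 : ∀ w, 0 ≤ F w := fun w => indicator_nonneg (fun w hw => h0 w (hsub hw)) w
  have hFm : ∫ w, F w ≤ 256 * A := by
    rw [hF, integral_indicator measurableSet_ball]
    exact mass_sixteenth_le hf h0 hU hInt
  obtain ⟨hci, hce⟩ := integrable_convolution_truncPow hFt one_pos
  have hker : ∀ z ∈ ball a (1 / 16), ∀ w ∈ ball a (1 / 16),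
      0 ≤ -log ‖z - w‖ ∧ -log ‖z - w‖ ≤ truncPow 1 (z - w) := by
    intro z hz w hw
    have hd : ‖z - w‖ < 1 := by
      rw [← dist_eq_norm]
      have := dist_triangle_right z w a
      rw [mem_ball] at hz hw
      linarith
    have hl : log ‖z - w‖ ≤ 0 := log_nonpos (norm_nonneg _) hd.le
    have hm : z - w ∈ ball (0 : ℂ) 1 := by simpa using hd
    refine ⟨by linarith, ?_⟩
    rw [truncPow, indicator_of_mem hm, truncLog, indicator_of_mem hm, log_one]
    have := add_one_le_exp (3 / 2 * (0 - log ‖z - w‖))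
    linarith
  have hPF0 : ∀ z ∈ ball a (1 / 16), 0 ≤ logPot F z := by
    intro z hz
    refine integral_nonneg fun w => ?_
    by_cases hw : w ∈ ball a (1 / 16)
    · exact mul_nonneg (hker z hz w hw).1 (hF0 w)
    · have : F w = 0 := indicator_of_notMem hw _
      simp [this]
  have hPF : ∀ z ∈ ball a (1 / 16), logPot F z ≤ ∫ w, truncPow 1 (z - w) * F w := by
    intro z hz
    refine integral_mono (hFt.integrable_neg_log_mul z) (hFt.integrable_truncPow_mul one_pos z)
      fun w => ?_
    by_cases hw : w ∈ ball a (1 / 16)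
    · exact mul_le_mul_of_nonneg_right (hker z hz w hw).2 (hF0 w)
    · have : F w = 0 := indicator_of_notMem hw _
      simp [this]
  have hei : IntegrableOn (fun z => exp (logPot f z)) (ball a (1 / 4)) := by
    simpa using hf.integrableOn_exp_logPot 1 a (1 / 4)
  have hbound : ∀ z ∈ ball a (1 / 16), |logPot G z| ≤
      exp (logPot f z) + ∫ w, truncPow 1 (z - w) * F w := by
    intro z hz
    have h1 := hsplit z
    have h2 := hPF0 z hz
    have h3 := hPF z hz
    have h4 := hU z (hsub hz)
    have h5 := add_one_le_exp (logPot f z)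
    rw [abs_le]
    constructor <;> linarith
  have hmG := hGt.measurable_logPot
  have hi2 : IntegrableOn (fun z => exp (logPot f z) + ∫ w, truncPow 1 (z - w) * F w)
      (ball a (1 / 16)) := (hei.mono_set hsub).add hci.integrableOn
  have hi1 : IntegrableOn (fun z => |logPot G z|) (ball a (1 / 16)) := by
    refine hi2.mono' (Measurable.aestronglyMeasurable (by fun_prop)) ?_
    filter_upwards [ae_restrict_mem measurableSet_ball] with z hz
    rw [norm_eq_abs, abs_abs]
    exact hbound z hz
  refine (setIntegral_mono_on hi1 hi2 measurableSet_ball hbound).trans ?_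
  rw [integral_add (hei.mono_set hsub) hci.integrableOn]
  have h1 := (setIntegral_mono_set hei (.of_forall fun z => (exp_pos _).le)
    hsub.eventuallyLE).trans hInt
  have h2 := setIntegral_le_integral (s := ball a (1 / 16)) hci
    (.of_forall fun z => integral_nonneg fun w => mul_nonneg (truncPow_nonneg _ _) (hF0 w))
  rw [hce] at h2
  have h3 : 0 ≤ ∫ w, F w := integral_nonneg hF0
  nlinarith [pi_lt_four]

/-- The radius on which the reverse Hölder inequality for `exp (logPot f)` holds. -/
noncomputable def coreRadius (A : ℝ) : ℝ := exp (-(32 * A)) / (8192 * A)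

theorem coreRadius_pos {A : ℝ} (hA : 1 ≤ A) : 0 < coreRadius A := by
  unfold coreRadius; positivity

theorem coreRadius_mul (A : ℝ) (hA : 1 ≤ A) : coreRadius A * (8192 * A) = exp (-(32 * A)) := by
  have : A ≠ 0 := by positivity
  rw [coreRadius]; field_simp

theorem exp_neg_le_of_one_le {A : ℝ} (hA : 1 ≤ A) : exp (-(32 * A)) * 262208 ≤ 1 := by
  have h1 : (2 : ℝ) ≤ exp 1 := by linarith [add_one_le_exp (1 : ℝ)]
  have h2 : (2 : ℝ) ^ 32 ≤ exp (32 * A) := by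
    calc (2 : ℝ) ^ 32 ≤ exp 1 ^ 32 := by gcongr
      _ = exp 32 := by rw [← exp_nat_mul]; norm_num
      _ ≤ _ := exp_le_exp.2 (by linarith)
  rw [exp_neg, inv_mul_le_iff₀ (exp_pos _)]
  linarith

theorem coreRadius_le {A : ℝ} (hA : 1 ≤ A) : coreRadius A ≤ 1 / 64 := by
  have h1 := coreRadius_mul A hA
  have h2 := exp_neg_le_of_one_le hA
  have h3 := coreRadius_pos hA
  nlinarith

theorem ringPot_coreRadius_le {f : ℂ → ℝ} {a : ℂ} {A : ℝ} (hf : IsTame f)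
    (h0 : ∀ w ∈ ball a (1 / 4), 0 ≤ f w) (hA : 1 ≤ A)
    (hInt : ∫ z in ball a (1 / 4), exp (logPot f z) ≤ A) :
    ringPot f a (4 * coreRadius A) ≤ 88 * A := by
  have hs := coreRadius_pos hA
  have hs' := coreRadius_le hA
  have h := exp_ringPot_le hf h0 hInt (r := 4 * coreRadius A) (by linarith) (by linarith)
  rw [← exp_le_exp]
  refine h.trans ?_
  have h1 : (2 : ℝ) ≤ exp 1 := by linarith [add_one_le_exp (1 : ℝ)]
  have h2 : A ≤ exp A := by linarith [add_one_le_exp A]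
  have h3 : (2 : ℝ) ^ 21 ≤ exp (21 * A) := by
    calc (2 : ℝ) ^ 21 ≤ exp 1 ^ 21 := by gcongr
      _ = exp 21 := by rw [← exp_nat_mul]; norm_num
      _ ≤ _ := exp_le_exp.2 (by linarith)
  have h4 : A / (2 * (4 * coreRadius A) ^ 2) = A ^ 3 * 2 ^ 21 * exp (64 * A) := by
    have e : exp (64 * A) = (exp (-(32 * A)) ^ 2)⁻¹ := by
      rw [← exp_nat_mul, ← exp_neg]; congr 1; push_cast; ring
    have : A ≠ 0 := by positivity
    rw [e, coreRadius]
    field_simp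
    norm_num
  rw [h4]
  calc A ^ 3 * 2 ^ 21 * exp (64 * A) ≤ exp A ^ 3 * exp (21 * A) * exp (64 * A) := by gcongr
    _ = exp (88 * A) := by
      rw [← exp_nat_mul, ← exp_add, ← exp_add]; congr 1; push_cast; ring

theorem integral_exp_core_le {f : ℂ → ℝ} {a : ℂ} {A ε : ℝ} (hf : IsTame f)
    (h0 : ∀ w ∈ ball a (1 / 4), 0 ≤ f w) (hU : ∀ z ∈ ball a (1 / 4), 0 ≤ logPot f z)
    (hA : 1 ≤ A) (hInt : ∫ z in ball a (1 / 4), exp (logPot f z) ≤ A) (hε : 0 ≤ ε)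
    (hεA : ε * (128 * A) ≤ 1) :
    ∫ z in ball a (coreRadius A), exp ((1 + ε) * logPot f z) ≤
      128000 * exp 10 * ∫ z in ball a (2 * coreRadius A), exp (logPot f z) := by
  have hs := coreRadius_pos hA
  have hs' := coreRadius_le hA
  have hsA := coreRadius_mul A hA
  have hring := ringPot_coreRadius_le hf h0 hA hInt
  have hEx := exp_neg_le_of_one_le hA
  have hcore := mass_core_le hf h0 hU hA hInt
  have hmass := mass_sixteenth_le hf h0 hU hInt
  have hfar := integral_abs_logPot_far_le hf h0 hU hInt
  set s := coreRadius A with hsdef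
  set r₀ := exp (-(32 * A)) / 8 with hr₀
  have hr₀s : r₀ = 1024 * A * s := by rw [hr₀, ← hsA]; ring
  have hr₀pos : 0 < r₀ := by positivity
  have h4s : 4 * s ≤ r₀ := by rw [hr₀s]; nlinarith
  have hr₀' : r₀ ≤ 1 / 16 := by rw [hr₀]; linarith
  have hsub : ball a (1 / 16) ⊆ ball a (1 / 4) := ball_subset_ball (by norm_num)
  have hsub4 : ball a (4 * s) ⊆ ball a (1 / 16) := ball_subset_ball (by linarith)
  have hsub0 : ball a r₀ ⊆ ball a (1 / 16) := ball_subset_ball hr₀'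
  set f₁ := (ball a (4 * s)).indicator f with hf₁
  set f₂ := (ball a (1 / 16) \ ball a (4 * s)).indicator f with hf₂
  set f₃ := (ball a (1 / 16))ᶜ.indicator f with hf₃
  have t₁ : IsTame f₁ := hf.indicator measurableSet_ball
  have t₂ : IsTame f₂ := hf.indicator (measurableSet_ball.diff measurableSet_ball)
  have t₃ : IsTame f₃ := hf.indicator measurableSet_ball.compl
  have p₁ : ∀ w, 0 ≤ f₁ w := indicator_nonneg fun w hw => h0 w (hsub (hsub4 hw))
  have p₂ : ∀ w, 0 ≤ f₂ w := indicator_nonneg fun w hw => h0 w (hsub hw.1)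
  have hadd : ∀ w, f w = f₁ w + (f₂ w + f₃ w) := by
    intro w
    by_cases h1 : w ∈ ball a (4 * s)
    · have e1 : f₁ w = f w := indicator_of_mem h1 _
      have e2 : f₂ w = 0 := indicator_of_notMem (fun h => h.2 h1) _
      have e3 : f₃ w = 0 := indicator_of_notMem (notMem_compl_iff.2 (hsub4 h1)) _
      linarith
    · have e1 : f₁ w = 0 := indicator_of_notMem h1 _
      by_cases h2 : w ∈ ball a (1 / 16)
      · have e2 : f₂ w = f w := indicator_of_mem (mem_sdiff_of_mem h2 h1) _
        have e3 : f₃ w = 0 := indicator_of_notMem (notMem_compl_iff.2 h2) _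
        linarith
      · have e2 : f₂ w = 0 := indicator_of_notMem (fun h => h2 h.1) _
        have e3 : f₃ w = f w := indicator_of_mem h2 _
        linarith
  have t₂₃ : IsTame fun w => f₂ w + f₃ w := by
    have : (fun w => f₂ w + f₃ w) = (ball a (4 * s))ᶜ.indicator f := by
      funext w
      have := hadd w
      by_cases h1 : w ∈ ball a (4 * s)
      · have e1 : f₁ w = f w := indicator_of_mem h1 _
        rw [indicator_of_notMem (by simpa using h1)]; linarith
      · have e1 : f₁ w = 0 := indicator_of_notMem h1 _
        rw [indicator_of_mem h1]; linarith
    rw [this]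
    exact hf.indicator measurableSet_ball.compl
  have hpot : ∀ z, logPot f z = logPot f₁ z + (logPot f₂ z + logPot f₃ z) := by
    intro z
    rw [← logPot_add t₂ t₃, ← logPot_add t₁ t₂₃]
    congr 1
    exact funext hadd
  have hint0 : IntegrableOn f (ball a (1 / 16)) := hf.integrable.integrableOn
  have hnn : 0 ≤ᵐ[volume.restrict (ball a (1 / 16))] f := by
    filter_upwards [ae_restrict_mem measurableSet_ball] with w hw using h0 w (hsub hw)
  have hM₁ : ∫ w, f₁ w ≤ 2 - 1 / (32 * A) := by
    rw [hf₁, integral_indicator measurableSet_ball]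
    refine (setIntegral_mono_set (hint0.mono_set hsub0) ?_
      (ball_subset_ball h4s).eventuallyLE).trans hcore
    exact ae_restrict_of_ae_restrict_of_subset hsub0 hnn
  have hM₁0 : 0 ≤ ∫ w, f₁ w := integral_nonneg p₁
  have hM₂ : ∫ w, f₂ w ≤ 256 * A := by
    rw [hf₂, integral_indicator (measurableSet_ball.diff measurableSet_ball)]
    exact (setIntegral_mono_set hint0 hnn sdiff_subset.eventuallyLE).trans hmass
  have hM₂' : ∫ w in ball a r₀, f₂ w ≤ 2 := by
    refine (setIntegral_mono_on t₂.integrable.integrableOn hf.integrable.integrableOn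
      measurableSet_ball fun w hw => ?_).trans (hcore.trans ?_)
    · exact indicator_le_self' (fun _ _ => h0 w (hsub (hsub0 hw))) w
    · have : 0 ≤ 1 / (32 * A) := by positivity
      linarith
  have hosc₂ : ∀ z ∈ ball a (2 * s), |logPot f₂ z - logPot f₂ a| ≤ 3 := by
    intro z hz
    have hz' : ‖z - a‖ ≤ 2 * s := by rw [← dist_eq_norm]; exact (mem_ball.1 hz).le
    have h := abs_logPot_sub_le t₂ p₂ hs
      (fun w hw => indicator_of_notMem (fun h => h.2 hw) _) h4s hz'
    have h' : 4 * s / r₀ * ∫ w, f₂ w ≤ 4 * s / r₀ * (256 * A) := by gcongr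
    have h'' : 4 * s / r₀ * (256 * A) = 1 := by
      have : A ≠ 0 := by positivity
      rw [hr₀s]; field_simp; norm_num
    linarith
  have hosc₃ : ∀ z ∈ ball a (2 * s), |logPot f₃ z - logPot f₃ a| ≤ 1 := by
    intro z hz
    have hz' : ‖z - a‖ ≤ 2 * s := by rw [← dist_eq_norm]; exact (mem_ball.1 hz).le
    have h := abs_logPot_sub_le_of_far t₃ (a := a) (z := z)
      (fun w hw => indicator_of_notMem (notMem_compl_iff.2 hw) _) (by linarith)
    have h' : ‖z - a‖ * 64 ^ 3 * ∫ y in ball a (1 / 16), |logPot f₃ y| ≤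
        2 * s * 64 ^ 3 * (4097 * A) := by gcongr
    have h'' : 2 * s * 64 ^ 3 * (4097 * A) = (s * (8192 * A)) * 262208 := by ring
    rw [h'', hsA] at h'
    linarith
  set M := ∫ w, f₁ w with hM
  set g : ℂ → ℝ := fun z => logPot f₂ z + logPot f₃ z - M * log (8 * s) with hg
  have hga : g a ≤ 88 * A := by
    refine le_trans ?_ hring
    have e : ringPot f a (4 * s) = logPot f₂ a + logPot f₃ a - M * log (4 * s) := by
      rw [← logPot_add t₂ t₃, logPot, ringPot, hM, ← integral_mul_const,
        ← integral_sub (t₂₃.integrable_neg_log_mul a) (t₁.integrable.mul_const _)]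
      refine integral_congr_ae (.of_forall fun w => ?_)
      simp only
      have := hadd w
      by_cases h1 : w ∈ ball a (4 * s)
      · have e1 : f₁ w = f w := indicator_of_mem h1 _
        have e2 : f₂ w + f₃ w = 0 := by linarith
        rw [e1, e2, max_eq_left (by rw [← dist_eq_norm]; exact (mem_ball.1 h1).le)]
        ring
      · have e1 : f₁ w = 0 := indicator_of_notMem h1 _
        have e2 : f₂ w + f₃ w = f w := by linarith
        rw [e1, e2, norm_sub_rev a w,
          max_eq_right (by rw [← dist_eq_norm]; exact not_lt.1 h1)]
        ring
    rw [e]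
    have : M * log (4 * s) ≤ M * log (8 * s) := by
      gcongr; linarith
    simp only [hg]
    linarith
  have hgosc : ∀ z ∈ ball a (2 * s), |g z - g a| ≤ 4 := by
    intro z hz
    have h2 := abs_le.1 (hosc₂ z hz)
    have h3 := abs_le.1 (hosc₃ z hz)
    rw [abs_le]
    simp only [hg]
    constructor <;> linarith
  have hεA' : ε * g a ≤ 1 := by nlinarith
  have hε8 : ε ≤ 1 / 8 := by nlinarith
  have hloc := local_estimate t₁ p₁ (a := a) hs (η := 1 / (32 * A)) (by positivity) hM₁ hε hε8 (by
    rw [div_div, le_div_iff₀ (by positivity)]; linarith)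
  rw [← hM] at hloc
  have hUg : ∀ z, logPot f z = logPot f₁ z + M * log (8 * s) + g z := by
    intro z; rw [hpot]; simp only [hg]; ring
  have hiP : ∀ k t, IntegrableOn (fun z => exp (k * (logPot f₁ z + M * log (8 * s)))) (ball a t) := by
    intro k t
    simp only [mul_add, exp_add]
    exact (t₁.integrableOn_exp_logPot k a t).mul_const _
  have step1 : ∫ z in ball a s, exp ((1 + ε) * logPot f z) ≤
      exp ((1 + ε) * (g a + 4)) *
        ∫ z in ball a s, exp ((1 + ε) * (logPot f₁ z + M * log (8 * s))) := by
    rw [← integral_const_mul]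
    refine setIntegral_mono_on (hf.integrableOn_exp_logPot _ _ _) ((hiP _ _).const_mul _)
      measurableSet_ball fun z hz => ?_
    have := (abs_le.1 (hgosc z (ball_subset_ball (by linarith) hz))).2
    rw [← exp_add, exp_le_exp, hUg z]
    nlinarith
  have step2 : ∫ z in ball a (2 * s), exp (logPot f₁ z + M * log (8 * s)) ≤
      exp (4 - g a) * ∫ z in ball a (2 * s), exp (logPot f z) := by
    rw [← integral_const_mul]
    refine setIntegral_mono_on (by simpa using hiP 1 (2 * s))
      (Integrable.const_mul (by simpa [IntegrableOn] using hf.integrableOn_exp_logPot 1 a (2 * s)) _)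
      measurableSet_ball fun z hz => ?_
    have := (abs_le.1 (hgosc z hz)).1
    rw [← exp_add, exp_le_exp, hUg z]
    linarith
  set I := ∫ z in ball a (2 * s), exp (logPot f z) with hI
  have hI0 : 0 ≤ I := integral_nonneg fun z => (exp_pos _).le
  calc ∫ z in ball a s, exp ((1 + ε) * logPot f z)
      ≤ exp ((1 + ε) * (g a + 4)) * (128000 * (exp (4 - g a) * I)) := by
        refine step1.trans ?_
        gcongr
        refine hloc.trans ?_
        gcongr
    _ = 128000 * exp ((1 + ε) * (g a + 4) + (4 - g a)) * I := by rw [exp_add]; ring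
    _ ≤ 128000 * exp 10 * I := by
        gcongr
        nlinarith

theorem lintegral_lintegral_ball {G : ℂ → ℝ≥0∞} (hG : Measurable G) (S : Set ℂ) (t : ℝ) :
    ∫⁻ a in S, ∫⁻ z in ball a t, G z = ∫⁻ z, G z * volume (ball z t ∩ S) := by
  have hset : MeasurableSet {p : ℂ × ℂ | p.2 ∈ ball p.1 t} := by
    have : IsOpen {p : ℂ × ℂ | dist p.2 p.1 < t} := isOpen_lt (by fun_prop) (by fun_prop)
    exact this.measurableSet
  have hm : Measurable fun p : ℂ × ℂ => {p : ℂ × ℂ | p.2 ∈ ball p.1 t}.indicator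
      (fun p => G p.2) p := (hG.comp measurable_snd).indicator hset
  calc ∫⁻ a in S, ∫⁻ z in ball a t, G z
      = ∫⁻ a in S, ∫⁻ z, {p : ℂ × ℂ | p.2 ∈ ball p.1 t}.indicator (fun p => G p.2) (a, z) := by
        refine lintegral_congr fun a => ?_
        rw [← lintegral_indicator measurableSet_ball]
        rfl
    _ = ∫⁻ z, ∫⁻ a in S, {p : ℂ × ℂ | p.2 ∈ ball p.1 t}.indicator (fun p => G p.2) (a, z) :=
        lintegral_lintegral_swap hm.aemeasurable
    _ = ∫⁻ z, G z * volume (ball z t ∩ S) := by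
        refine lintegral_congr fun z => ?_
        have : ∀ a, {p : ℂ × ℂ | p.2 ∈ ball p.1 t}.indicator (fun p => G p.2) (a, z) =
            (ball z t).indicator (fun _ => G z) a := fun a => by
          simp only [indicator, mem_ofPred_eq, mem_ball, dist_comm a z]
        simp only [this]
        rw [lintegral_indicator measurableSet_ball, setLIntegral_const,
          Measure.restrict_apply measurableSet_ball]

theorem lintegral_exp_logPot_le {f : ℂ → ℝ} {A ε : ℝ} (hf : IsTame f)
    (h0 : ∀ w ∈ ball (0 : ℂ) (7 / 8), 0 ≤ f w)
    (hU : ∀ z ∈ ball (0 : ℂ) (7 / 8), 0 ≤ logPot f z) (hA : 1 ≤ A)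
    (hInt : ∫⁻ z in ball (0 : ℂ) (7 / 8), .ofReal (exp (logPot f z)) ≤ .ofReal A) (hε : 0 ≤ ε)
    (hεA : ε * (128 * A) ≤ 1) :
    ∫⁻ z in ball (0 : ℂ) (1 / 2), .ofReal (exp ((1 + ε) * logPot f z)) ≤
      .ofReal (512000 * exp 10 * A) := by
  have hs := coreRadius_pos hA
  have hs' := coreRadius_le hA
  set s := coreRadius A with hsdef
  have hm := hf.measurable_logPot
  have hi1 : ∀ a t, IntegrableOn (fun z => exp (logPot f z)) (ball a t) := fun a t => by
    simpa using hf.integrableOn_exp_logPot 1 a t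
  have hcenter : ∀ a ∈ ball (0 : ℂ) (5 / 8),
      ∫⁻ z in ball a s, .ofReal (exp ((1 + ε) * logPot f z)) ≤
        .ofReal (128000 * exp 10) * ∫⁻ z in ball a (2 * s), .ofReal (exp (logPot f z)) := by
    intro a ha
    have hsub : ball a (1 / 4) ⊆ ball (0 : ℂ) (7 / 8) :=
      ball_subset_ball' (by have := mem_ball.1 ha; linarith)
    have hInt' : ∫ z in ball a (1 / 4), exp (logPot f z) ≤ A := by
      rw [← ENNReal.ofReal_le_ofReal_iff (by linarith), ofReal_integral_eq_lintegral_ofReal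
        (hi1 _ _) (.of_forall fun z => (exp_pos _).le)]
      exact (lintegral_mono_set hsub).trans hInt
    have := integral_exp_core_le hf (fun w hw => h0 w (hsub hw)) (fun z hz => hU z (hsub hz))
      hA hInt' hε hεA
    rw [← ofReal_integral_eq_lintegral_ofReal (hf.integrableOn_exp_logPot _ _ _)
      (.of_forall fun z => (exp_pos _).le), ← ofReal_integral_eq_lintegral_ofReal
        (hi1 _ _) (.of_forall fun z => (exp_pos _).le), ← ENNReal.ofReal_mul (by positivity)]
    exact ENNReal.ofReal_le_ofReal this
  have hvol : ∀ (z : ℂ) (t : ℝ), volume (ball z t) = volume (ball (0 : ℂ) t) := fun z t => by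
    rw [Complex.volume_ball, Complex.volume_ball]
  have hvol2 : volume (ball (0 : ℂ) (2 * s)) = 4 * volume (ball (0 : ℂ) s) := by
    rw [Complex.volume_ball, Complex.volume_ball, ENNReal.ofReal_mul (by norm_num), mul_pow,
      ← mul_assoc]
    norm_num
  have hG1 : Measurable fun z => ENNReal.ofReal (exp ((1 + ε) * logPot f z)) := by fun_prop
  have hG0 : Measurable fun z => ENNReal.ofReal (exp (logPot f z)) := by fun_prop
  set S := ball (0 : ℂ) (5 / 8) with hS
  have lower : volume (ball (0 : ℂ) s) *
      ∫⁻ z in ball (0 : ℂ) (1 / 2), .ofReal (exp ((1 + ε) * logPot f z)) ≤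
      ∫⁻ a in S, ∫⁻ z in ball a s, .ofReal (exp ((1 + ε) * logPot f z)) := by
    rw [lintegral_lintegral_ball hG1, mul_comm, ← lintegral_mul_const _ hG1,
      ← lintegral_indicator measurableSet_ball]
    refine lintegral_mono (indicator_le fun z hz => ?_)
    rw [inter_eq_self_of_subset_left (ball_subset_ball' (by have := mem_ball.1 hz; linarith)),
      hvol z]
  have upper : ∫⁻ a in S, ∫⁻ z in ball a (2 * s), .ofReal (exp (logPot f z)) ≤
      volume (ball (0 : ℂ) (2 * s)) * .ofReal A := by
    rw [lintegral_lintegral_ball hG0]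
    refine le_trans ?_ (mul_le_mul_right hInt _)
    rw [mul_comm (volume _), ← lintegral_mul_const _ hG0, ← lintegral_indicator measurableSet_ball]
    refine lintegral_mono fun z => ?_
    by_cases hz : z ∈ ball (0 : ℂ) (7 / 8)
    · rw [indicator_of_mem hz]
      simp only [← hvol z]
      gcongr
      exact inter_subset_left
    · have : ball z (2 * s) ∩ S = ∅ := by
        rw [eq_empty_iff_forall_notMem]
        rintro w ⟨hw1, hw2⟩
        have := dist_triangle_left z 0 w
        rw [mem_ball] at hw1 hw2 hz
        linarith
      simp [this]
  have hvpos : volume (ball (0 : ℂ) s) ≠ 0 := (measure_ball_pos _ _ hs).ne'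
  rw [← ENNReal.mul_le_mul_iff_right hvpos measure_ball_lt_top.ne]
  calc _ ≤ _ := lower
    _ ≤ ∫⁻ a in S, .ofReal (128000 * exp 10) *
          ∫⁻ z in ball a (2 * s), .ofReal (exp (logPot f z)) :=
        setLIntegral_mono' measurableSet_ball hcenter
    _ = .ofReal (128000 * exp 10) *
          ∫⁻ a in S, ∫⁻ z in ball a (2 * s), .ofReal (exp (logPot f z)) :=
        lintegral_const_mul' _ _ ENNReal.ofReal_ne_top
    _ ≤ .ofReal (128000 * exp 10) * (volume (ball (0 : ℂ) (2 * s)) * .ofReal A) := by gcongr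
    _ = volume (ball (0 : ℂ) s) * .ofReal (512000 * exp 10 * A) := by
        rw [hvol2, show 512000 * exp 10 * A = 128000 * exp 10 * (4 * A) by ring,
          ENNReal.ofReal_mul (p := 128000 * exp 10) (by positivity),
          ENNReal.ofReal_mul (p := 4) (by norm_num)]
        norm_num
        ring

/-- The radial density of the uniform probability measure on the annulus `h / 2 ≤ |w| < h`. -/
noncomputable def ringWeight (h r : ℝ) : ℝ :=
  (Ico (h / 2) h).indicator (fun _ => (π * (h ^ 2 - (h / 2) ^ 2))⁻¹) r

/-- The potential of a point mass minus that of the uniform measure on an annulus around it. -/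
noncomputable def smoothKernel (h t : ℝ) : ℝ :=
  -log t - ringPot (fun w => ringWeight h ‖w‖) 0 t

section kernel

variable {h t : ℝ}

theorem ringWeight_const_pos (hh : 0 < h) : 0 < (π * (h ^ 2 - (h / 2) ^ 2))⁻¹ := by
  have : 0 < h ^ 2 - (h / 2) ^ 2 := by nlinarith
  positivity

theorem measurable_ringWeight (h : ℝ) : Measurable (ringWeight h) :=
  measurable_const.indicator measurableSet_Ico

theorem ringWeight_nonneg (hh : 0 < h) (r : ℝ) : 0 ≤ ringWeight h r :=
  indicator_nonneg (fun _ _ => (ringWeight_const_pos hh).le) r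

theorem ringWeight_le (hh : 0 < h) (r : ℝ) : ringWeight h r ≤ (π * (h ^ 2 - (h / 2) ^ 2))⁻¹ :=
  indicator_le_self' (fun _ _ => (ringWeight_const_pos hh).le) r

theorem ringWeight_of_le {r : ℝ} (hr : h ≤ r) : ringWeight h r = 0 :=
  indicator_of_notMem (fun hm => hm.2.not_ge hr) _

theorem isTame_ringWeight (hh : 0 < h) (c : ℂ) : IsTame fun z => ringWeight h ‖z - c‖ := by
  have := measurable_ringWeight h
  refine IsTame.of_bounded_on_ball (c := c) (t := h) (B := (π * (h ^ 2 - (h / 2) ^ 2))⁻¹)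
    (by fun_prop) (fun z _ => ?_) fun z hz => ?_
  · rw [abs_of_nonneg (ringWeight_nonneg hh _)]; exact ringWeight_le hh _
  · exact ringWeight_of_le (by simpa [mem_ball, dist_eq_norm] using hz)

theorem integral_ringWeight (hh : 0 < h) (c : ℂ) : ∫ z, ringWeight h ‖z - c‖ = 1 := by
  have e : (fun z => ringWeight h ‖z - c‖) =
      (annulus c (h / 2) h).indicator fun _ => (π * (h ^ 2 - (h / 2) ^ 2))⁻¹ := rfl
  rw [e, integral_indicator (measurableSet_annulus _ _ _), setIntegral_const,
    volume_real_annulus c (by linarith) (by linarith), smul_eq_mul]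
  exact mul_inv_cancel₀ (inv_pos.1 (ringWeight_const_pos hh)).ne'

theorem smoothKernel_eq_integral (hh : 0 < h) (t : ℝ) :
    smoothKernel h t = ∫ w : ℂ, (log (max t ‖w‖) - log t) * ringWeight h ‖w‖ := by
  have ht := isTame_ringWeight hh 0
  have h1 := integral_ringWeight hh 0
  have h2 := ht.integrable_log_max_mul 0 t
  have h3 := ht.integrable.const_mul (log t)
  simp only [sub_zero] at h1 h2 h3
  simp only [sub_mul]
  rw [integral_sub h2 h3, integral_const_mul, h1, smoothKernel, ringPot]
  simp only [neg_mul, integral_neg, sub_zero]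
  ring

theorem smoothKernel_of_le (hh : 0 < h) (ht : h ≤ t) : smoothKernel h t = 0 := by
  rw [smoothKernel_eq_integral hh]
  refine integral_eq_zero_of_ae (.of_forall fun w => ?_)
  rcases lt_or_ge ‖w‖ h with hw | hw
  · simp [max_eq_left (hw.le.trans ht)]
  · simp [ringWeight_of_le hw]

theorem integrable_smoothKernel_integrand (hh : 0 < h) (t : ℝ) :
    Integrable fun w : ℂ => (log (max t ‖w‖) - log t) * ringWeight h ‖w‖ := by
  have ht := isTame_ringWeight hh 0
  have h2 := (ht.integrable_log_max_mul 0 t).sub (ht.integrable.const_mul (log t))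
  refine h2.congr (.of_forall fun w => ?_)
  simp only [sub_zero, Pi.sub_apply]
  ring

theorem smoothKernel_nonneg (hh : 0 < h) (ht : 0 < t) : 0 ≤ smoothKernel h t := by
  rw [smoothKernel_eq_integral hh]
  refine integral_nonneg fun w => mul_nonneg (sub_nonneg.2 ?_) (ringWeight_nonneg hh _)
  exact log_le_log ht (le_max_left _ _)

theorem log_two_le_smoothKernel (hh : 0 < h) (ht : 0 < t) (ht' : t ≤ h / 4) :
    log 2 ≤ smoothKernel h t := by
  have h1 := integral_ringWeight hh 0
  have h3 := (isTame_ringWeight hh 0).integrable.const_mul (log 2)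
  simp only [sub_zero] at h1 h3
  rw [smoothKernel_eq_integral hh, ← mul_one (log 2), ← h1, ← integral_const_mul]
  refine integral_mono h3 (integrable_smoothKernel_integrand hh t) fun w => ?_
  simp only
  by_cases hw : ‖w‖ ∈ Ico (h / 2) h
  · refine mul_le_mul_of_nonneg_right ?_ (ringWeight_nonneg hh _)
    rw [← log_div (by positivity) ht.ne']
    refine log_le_log two_pos ?_
    rw [le_div_iff₀ ht]
    exact le_trans (by linarith [hw.1]) (le_max_right _ _)
  · have : ringWeight h ‖w‖ = 0 := indicator_of_notMem hw _
    simp [this]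

theorem smoothKernel_le (hh : 0 < h) (ht : 0 < t) (ht' : t ≤ h) :
    smoothKernel h t ≤ log h - log t := by
  have h1 := integral_ringWeight hh 0
  have h3 := (isTame_ringWeight hh 0).integrable.const_mul (log h - log t)
  simp only [sub_zero] at h1 h3
  rw [smoothKernel_eq_integral hh, ← mul_one (log h - log t), ← h1, ← integral_const_mul]
  refine integral_mono (integrable_smoothKernel_integrand hh t) h3 fun w => ?_
  simp only
  rcases lt_or_ge ‖w‖ h with hw | hw
  · refine mul_le_mul_of_nonneg_right ?_ (ringWeight_nonneg hh _)
    gcongr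
    exact max_le ht' hw.le
  · simp [ringWeight_of_le hw]

theorem measurable_smoothKernel (hh : 0 < h) : Measurable (smoothKernel h) := by
  have ht := isTame_ringWeight hh 0
  simp only [sub_zero] at ht
  have := ht.measurable_ringPot 0
  unfold smoothKernel
  fun_prop

theorem integrable_smoothKernel_norm (hh : 0 < h) :
    Integrable fun z : ℂ => smoothKernel h ‖z‖ := by
  have hm := measurable_smoothKernel hh
  have hi : Integrable ((ball (0 : ℂ) h).indicator fun z => log h - log ‖z‖) :=
    (integrable_indicator_iff measurableSet_ball).2
      ((integrableOn_const measure_ball_lt_top.ne).sub (integrableOn_log_norm_ball h))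
  refine hi.mono' (Measurable.aestronglyMeasurable (by fun_prop)) ?_
  filter_upwards [compl_mem_ae_iff.2 (measure_singleton (0 : ℂ))] with z hz
  have hz0 : 0 < ‖z‖ := norm_pos_iff.2 hz
  rw [norm_of_nonneg (smoothKernel_nonneg hh hz0)]
  rcases lt_or_ge ‖z‖ h with hzh | hzh
  · rw [indicator_of_mem (by simpa using hzh)]
    exact smoothKernel_le hh hz0 hzh.le
  · rw [indicator_of_notMem (by simpa using hzh), smoothKernel_of_le hh hzh]

theorem integrable_smoothKernel (hh : 0 < h) (c : ℂ) :
    Integrable fun z : ℂ => smoothKernel h ‖z - c‖ :=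
  (integrable_smoothKernel_norm hh).comp_sub_right c

theorem integral_smoothKernel_pos (hh : 0 < h) : 0 < ∫ z : ℂ, smoothKernel h ‖z‖ := by
  have hnn : ∀ᵐ z : ℂ, 0 ≤ smoothKernel h ‖z‖ := by
    filter_upwards [compl_mem_ae_iff.2 (measure_singleton (0 : ℂ))] with z hz
    exact smoothKernel_nonneg hh (norm_pos_iff.2 hz)
  have h1 : ∫ z in ball (0 : ℂ) (h / 4), log 2 ≤ ∫ z in ball (0 : ℂ) (h / 4), smoothKernel h ‖z‖ := by
    refine integral_mono_ae (integrableOn_const measure_ball_lt_top.ne)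
      (integrable_smoothKernel_norm hh).integrableOn ?_
    filter_upwards [ae_restrict_mem measurableSet_ball,
      ae_restrict_of_ae (compl_mem_ae_iff.2 (measure_singleton (0 : ℂ)))] with z hz hz0
    exact log_two_le_smoothKernel hh (norm_pos_iff.2 hz0) (by simpa using (mem_ball.1 hz).le)
  refine lt_of_lt_of_le ?_ (h1.trans (setIntegral_le_integral (integrable_smoothKernel_norm hh) hnn))
  rw [setIntegral_const, volume_real_ball _ (by positivity), smul_eq_mul]
  have := log_pos one_lt_two
  positivity

end kernel

/-- A function whose circle means about `a` are at most its value at `a` has the same property for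
all radial means. -/
theorem integral_radial_mul_le {W : ℂ → ℝ} {a : ℂ} {h : ℝ} {ψ : ℝ → ℝ} (hW : IsTame W)
    (hψi : Integrable fun z => ψ ‖z - a‖) (hψ0 : ∀ r, 0 < r → 0 ≤ ψ r)
    (hψh : ∀ r, h ≤ r → ψ r = 0)
    (hsm : ∀ᵐ r ∂volume.restrict (Ioi (0 : ℝ)), r < h → circleAverage W a r ≤ W a) :
    ∫ z, ψ ‖z - a‖ * W z ≤ W a * ∫ z, ψ ‖z - a‖ := by
  obtain ⟨B, hB⟩ := hW.bounded
  have hWm := hW.measurable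
  have hi : Integrable fun z => ψ ‖z - a‖ * W z :=
    hψi.mul_bdd (c := B) (Measurable.aestronglyMeasurable hWm) (.of_forall hB)
  rw [← sub_nonneg, ← integral_const_mul, ← integral_sub (hψi.const_mul _) hi,
    integral_eq_integral_circleAverage (F := fun z => W a * ψ ‖z - a‖ - ψ ‖z - a‖ * W z)
      ((hψi.const_mul _).sub hi) a]
  refine integral_nonneg_of_ae ?_
  filter_upwards [hsm, ae_circleIntegrable hW.integrable a, ae_restrict_mem measurableSet_Ioi]
    with r hr hri hr0
  have hr0' : (0 : ℝ) < r := hr0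
  have e : circleAverage (fun z => W a * ψ ‖z - a‖ - ψ ‖z - a‖ * W z) a r =
      ψ r * (W a - circleAverage W a r) := by
    rw [circleAverage_congr_sphere (f₂ := fun z => ψ r • (W a - W z)), circleAverage_fun_smul,
      circleAverage_fun_sub (circleIntegrable_const _ _ _) hri, circleAverage_const, smul_eq_mul]
    intro z hz
    have : ‖z - a‖ = r := by
      rw [← dist_eq_norm, mem_sphere.1 hz, abs_of_pos hr0']
    simp only [this, smul_eq_mul]
    ring
  show 0 ≤ 2 * π * r * _
  rw [e]
  have : 0 ≤ ψ r * (W a - circleAverage W a r) := by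
    rcases lt_or_ge r h with hrh | hrh
    · exact mul_nonneg (hψ0 r hr0') (sub_nonneg.2 (hr hrh))
    · simp [hψh r hrh]
  positivity

/-- The mean of `W` over the annulus `h / 2 ≤ |y - w| < h`. -/
noncomputable def annulusMean (h : ℝ) (W : ℂ → ℝ) (w : ℂ) : ℝ :=
  ∫ y, ringWeight h ‖y - w‖ * W y

theorem isTame_annulusMean {W : ℂ → ℝ} {h : ℝ} (hh : 0 < h) (hW : IsTame W) :
    IsTame (annulusMean h W) := by
  obtain ⟨B, hB⟩ := hW.bounded
  obtain ⟨ρ, hρ⟩ := hW.support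
  have hWm := hW.measurable
  have hwm := measurable_ringWeight h
  refine ⟨?_, ⟨(π * (h ^ 2 - (h / 2) ^ 2))⁻¹ * ∫ y, |W y|, fun w => ?_⟩, ρ + h, fun w hw => ?_⟩
  · exact (StronglyMeasurable.integral_prod_right'
      (f := fun p : ℂ × ℂ => ringWeight h ‖p.2 - p.1‖ * W p.2)
      (Measurable.stronglyMeasurable (by fun_prop))).measurable
  · rw [← integral_const_mul]
    refine abs_integral_le_integral_abs.trans (integral_mono_of_nonneg
      (.of_forall fun y => abs_nonneg _) (hW.integrable.abs.const_mul _) (.of_forall fun y => ?_))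
    simp only [abs_mul]
    rw [abs_of_nonneg (ringWeight_nonneg hh _)]
    gcongr
    exact ringWeight_le hh _
  · refine integral_eq_zero_of_ae (.of_forall fun y => ?_)
    simp only [Pi.zero_apply]
    rcases le_or_gt ρ ‖y‖ with hy | hy
    · simp [hρ y hy]
    · rw [ringWeight_of_le, zero_mul]
      have := norm_sub_norm_le w y
      rw [norm_sub_rev] at this
      linarith

theorem integrable_prod_log_ringWeight {W : ℂ → ℝ} {h : ℝ} (hh : 0 < h) (hW : IsTame W) (z : ℂ) :
    Integrable (fun p : ℂ × ℂ => -log ‖z - p.1‖ * (ringWeight h ‖p.2 - p.1‖ * W p.2))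
      (volume.prod volume) := by
  obtain ⟨ρ, hρ⟩ := hW.support
  have hWm := hW.measurable
  have hwm := measurable_ringWeight h
  have h1 : Integrable ((ball (0 : ℂ) (ρ + h)).indicator fun w => log ‖z - w‖) :=
    (integrable_indicator_iff measurableSet_ball).2 (integrableOn_log_norm_sub z 0 _)
  have h2 := (h1.mul_prod hW.integrable).bdd_mul (c := (π * (h ^ 2 - (h / 2) ^ 2))⁻¹)
    (f := fun p : ℂ × ℂ => -ringWeight h ‖p.2 - p.1‖)
    (Measurable.aestronglyMeasurable (by fun_prop)) (.of_forall fun p => by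
      rw [norm_neg, norm_of_nonneg (ringWeight_nonneg hh _)]; exact ringWeight_le hh _)
  refine h2.congr (.of_forall fun p => ?_)
  simp only
  by_cases hp : p.1 ∈ ball (0 : ℂ) (ρ + h)
  · rw [indicator_of_mem hp]; ring
  · rw [indicator_of_notMem hp]
    rw [mem_ball_zero_iff, not_lt] at hp
    rcases le_or_gt ρ ‖p.2‖ with hy | hy
    · simp [hρ _ hy]
    · rw [ringWeight_of_le]
      · ring
      · have := norm_sub_norm_le p.1 p.2
        rw [norm_sub_rev] at this
        linarith

theorem logPot_sub_annulusMean {W : ℂ → ℝ} {h : ℝ} (hh : 0 < h) (hW : IsTame W) (z : ℂ) :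
    logPot W z - logPot (annulusMean h W) z = ∫ y, smoothKernel h ‖y - z‖ * W y := by
  have hi := integrable_prod_log_ringWeight hh hW z
  have hinner : ∀ y, ∫ w, -log ‖z - w‖ * (ringWeight h ‖y - w‖ * W y) =
      ringPot (fun w => ringWeight h ‖w‖) 0 ‖y - z‖ * W y := by
    intro y
    have key := integral_radial_mul_log (isTame_ringWeight hh y) z
    have e1 : ∀ w, -log ‖z - w‖ * (ringWeight h ‖y - w‖ * W y) =
        -W y * (ringWeight h ‖w - y‖ * log ‖w - z‖) := fun w => by
      rw [norm_sub_rev z w, norm_sub_rev y w]; ring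
    simp only [e1]
    rw [integral_const_mul, key, ringPot, norm_sub_rev y z,
      integral_sub_right_eq_self (fun w => ringWeight h ‖w‖ * log (max ‖w‖ ‖z - y‖)) y,
      neg_mul, ← mul_neg, ← integral_neg, mul_comm]
    congr 1
    refine integral_congr_ae (.of_forall fun w => ?_)
    simp only [sub_zero, max_comm ‖w‖]
    ring
  have e2 : logPot (annulusMean h W) z =
      ∫ y, ringPot (fun w => ringWeight h ‖w‖) 0 ‖y - z‖ * W y := by
    simp only [logPot, annulusMean, ← integral_const_mul, ← hinner]
    exact integral_integral_swap hi
  have hi2 : Integrable fun y => ringPot (fun w => ringWeight h ‖w‖) 0 ‖y - z‖ * W y :=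
    hi.integral_prod_right.congr (.of_forall hinner)
  rw [e2, logPot, ← integral_sub (hW.integrable_neg_log_mul z) hi2]
  refine integral_congr_ae (.of_forall fun y => ?_)
  simp only [smoothKernel, norm_sub_rev z y]
  ring

theorem IsTame.const_mul_sub {f g : ℂ → ℝ} (hf : IsTame f) (hg : IsTame g) (k : ℝ) :
    IsTame fun w => k * (f w - g w) := by
  obtain ⟨B, hB⟩ := hf.bounded
  obtain ⟨B', hB'⟩ := hg.bounded
  obtain ⟨ρ, hρ⟩ := hf.support
  obtain ⟨ρ', hρ'⟩ := hg.support
  refine ⟨(hf.measurable.sub hg.measurable).const_mul k, ⟨|k| * (B + B'), fun w => ?_⟩,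
    max ρ ρ', fun w hw => ?_⟩
  · rw [abs_mul]
    gcongr
    exact (abs_sub _ _).trans (add_le_add (hB w) (hB' w))
  · simp [hρ w ((le_max_left _ _).trans hw), hρ' w ((le_max_right _ _).trans hw)]

theorem logPot_const_mul_sub {f g : ℂ → ℝ} (hf : IsTame f) (hg : IsTame g) (k : ℝ) (z : ℂ) :
    logPot (fun w => k * (f w - g w)) z = k * (logPot f z - logPot g z) := by
  simp only [logPot]
  rw [← integral_sub (hf.integrable_neg_log_mul z) (hg.integrable_neg_log_mul z),
    ← integral_const_mul]
  congr 1
  funext w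
  ring

/-- Bounded functions with the super-mean value property are approximated from below by
logarithmic potentials of positive measures. -/
theorem exists_logPot_approx {W : ℂ → ℝ} (hW : IsTame W) (h0 : ∀ z, 0 ≤ W z)
    (hsm : ∀ a, ∀ᵐ r ∂volume.restrict (Ioi (0 : ℝ)), ‖a‖ + r < 1 → circleAverage W a r ≤ W a)
    {h : ℝ} (hh : 0 < h) (hh' : h ≤ 1 / 8) :
    ∃ f, IsTame f ∧ (∀ w ∈ ball (0 : ℂ) (7 / 8), 0 ≤ f w) ∧ (∀ z, 0 ≤ logPot f z) ∧
      (∀ z ∈ ball (0 : ℂ) (7 / 8), logPot f z ≤ W z) ∧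
      ∀ z b, (∀ y ∈ ball z h, b ≤ W y) → b ≤ logPot f z := by
  obtain ⟨B, hB⟩ := hW.bounded
  have hWm := hW.measurable
  have hm := isTame_annulusMean hh hW
  have hκ := integral_smoothKernel_pos hh
  set κ := ∫ z : ℂ, smoothKernel h ‖z‖ with hκdef
  have hκz : ∀ z : ℂ, ∫ y, smoothKernel h ‖y - z‖ = κ := fun z =>
    integral_sub_right_eq_self (fun y : ℂ => smoothKernel h ‖y‖) z
  have hpot : ∀ z, logPot (fun w => κ⁻¹ * (W w - annulusMean h W w)) z =
      κ⁻¹ * ∫ y, smoothKernel h ‖y - z‖ * W y := fun z => by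
    rw [logPot_const_mul_sub hW hm, logPot_sub_annulusMean hh hW]
  have hne : ∀ z : ℂ, ∀ᵐ y : ℂ, 0 < ‖y - z‖ := fun z => by
    filter_upwards [compl_mem_ae_iff.2 (measure_singleton z)] with y hy
    exact norm_pos_iff.2 (sub_ne_zero.2 hy)
  have hi : ∀ z, Integrable fun y => smoothKernel h ‖y - z‖ * W y := fun z =>
    (integrable_smoothKernel hh z).mul_bdd (c := B) (Measurable.aestronglyMeasurable hWm)
      (.of_forall hB)
  have hsm' : ∀ a ∈ ball (0 : ℂ) (7 / 8),
      ∀ᵐ r ∂volume.restrict (Ioi (0 : ℝ)), r < h → circleAverage W a r ≤ W a := by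
    intro a ha
    rw [mem_ball_zero_iff] at ha
    filter_upwards [hsm a] with r hr hrh using hr (by linarith)
  refine ⟨_, hW.const_mul_sub hm κ⁻¹, fun w hw => ?_, fun z => ?_, fun z hz => ?_,
    fun z b hb => ?_⟩
  · have := integral_radial_mul_le hW (isTame_ringWeight hh w).integrable
      (fun r _ => ringWeight_nonneg hh r) (fun r => ringWeight_of_le) (hsm' w hw)
    rw [integral_ringWeight hh, mul_one] at this
    exact mul_nonneg (inv_pos.2 hκ).le (sub_nonneg.2 this)
  · rw [hpot]
    refine mul_nonneg (inv_pos.2 hκ).le (integral_nonneg_of_ae ?_)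
    filter_upwards [hne z] with y hy
    exact mul_nonneg (smoothKernel_nonneg hh hy) (h0 y)
  · rw [hpot, inv_mul_le_iff₀ hκ, mul_comm, ← hκz z]
    exact integral_radial_mul_le hW (integrable_smoothKernel hh z)
      (fun r => smoothKernel_nonneg hh) (fun r => smoothKernel_of_le hh) (hsm' z hz)
  · rw [hpot, le_inv_mul_iff₀ hκ, mul_comm, ← hκz z, ← integral_const_mul]
    refine integral_mono_ae ((integrable_smoothKernel hh z).const_mul _) (hi z) ?_
    filter_upwards [hne z] with y hy
    rw [mul_comm]
    rcases lt_or_ge ‖y - z‖ h with hyh | hyh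
    · exact mul_le_mul_of_nonneg_left (hb y (by rwa [mem_ball, dist_eq_norm]))
        (smoothKernel_nonneg hh hy)
    · simp [smoothKernel_of_le hh hyh]

theorem lintegral_exp_le_of_tendsto {U : ℕ → ℂ → ℝ} {W : ℂ → ℝ} {s : Set ℂ} {k : ℝ} {C : ℝ≥0∞}
    (hs : MeasurableSet s) (hU : ∀ n, Measurable (U n))
    (hlim : ∀ z ∈ s, Filter.Tendsto (fun n => U n z) Filter.atTop (nhds (W z)))
    (hC : ∀ n, ∫⁻ z in s, .ofReal (exp (k * U n z)) ≤ C) :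
    ∫⁻ z in s, .ofReal (exp (k * W z)) ≤ C := by
  calc ∫⁻ z in s, .ofReal (exp (k * W z))
      = ∫⁻ z in s, Filter.liminf (fun n => ENNReal.ofReal (exp (k * U n z))) Filter.atTop := by
        refine setLIntegral_congr_fun hs fun z hz => ?_
        have hc : Continuous fun x : ℝ => ENNReal.ofReal (exp (k * x)) :=
          ENNReal.continuous_ofReal.comp (by fun_prop)
        exact ((hc.tendsto _).comp (hlim z hz)).liminf_eq.symm
    _ ≤ Filter.liminf (fun n => ∫⁻ z in s, ENNReal.ofReal (exp (k * U n z))) Filter.atTop :=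
        lintegral_liminf_le fun n => by have := hU n; fun_prop
    _ ≤ C := Filter.liminf_le_of_le (by isBoundedDefault) fun b hb => by
        obtain ⟨n, hn⟩ := hb.exists
        exact hn.trans (hC n)

theorem lintegral_exp_le_of_superMean {W : ℂ → ℝ} {A ε : ℝ} (hW : IsTame W) (h0 : ∀ z, 0 ≤ W z)
    (hsm : ∀ a, ∀ᵐ r ∂volume.restrict (Ioi (0 : ℝ)), ‖a‖ + r < 1 → circleAverage W a r ≤ W a)
    (hlsc : LowerSemicontinuous W) (hA : 1 ≤ A)
    (hInt : ∫⁻ z in ball (0 : ℂ) 1, .ofReal (exp (W z)) ≤ .ofReal A) (hε : 0 ≤ ε)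
    (hεA : ε * (128 * A) ≤ 1) :
    ∫⁻ z in ball (0 : ℂ) (1 / 2), .ofReal (exp ((1 + ε) * W z)) ≤
      .ofReal (512000 * exp 10 * A) := by
  have hpos : ∀ n : ℕ, (0 : ℝ) < 1 / (8 * ((n : ℝ) + 1)) := fun n => by positivity
  have hle : ∀ n : ℕ, (1 : ℝ) / (8 * ((n : ℝ) + 1)) ≤ 1 / 8 := fun n =>
    one_div_le_one_div_of_le (by norm_num) (by linarith [n.cast_nonneg (α := ℝ)])
  choose f hft hf0 hfU hfW hfb using fun n => exists_logPot_approx hW h0 hsm (hpos n) (hle n)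
  refine lintegral_exp_le_of_tendsto (U := fun n => logPot (f n)) measurableSet_ball
    (fun n => (hft n).measurable_logPot) (fun z hz => ?_) fun n => ?_
  · rw [tendsto_order]
    refine ⟨fun b hb => ?_, fun b hb => .of_forall fun n => lt_of_le_of_lt
      (hfW n z (ball_subset_ball (by norm_num) hz)) hb⟩
    obtain ⟨b', hbb', hb'⟩ := exists_between hb
    obtain ⟨r, hr, hball⟩ := Metric.eventually_nhds_iff_ball.1 (hlsc z b' hb')
    obtain ⟨n₀, hn₀⟩ := exists_nat_one_div_lt hr
    filter_upwards [Filter.eventually_ge_atTop n₀] with n hn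
    refine hbb'.trans_le (hfb n z b' fun y hy => (hball y (ball_subset_ball ?_ hy)).le)
    refine le_trans (one_div_le_one_div_of_le (by positivity) ?_) hn₀.le
    have : (n₀ : ℝ) ≤ n := by exact_mod_cast hn
    linarith [n₀.cast_nonneg (α := ℝ)]
  · refine lintegral_exp_logPot_le (hft n) (hf0 n) (fun z _ => hfU n z) hA ?_ hε hεA
    calc ∫⁻ z in ball (0 : ℂ) (7 / 8), .ofReal (exp (logPot (f n) z))
        ≤ ∫⁻ z in ball (0 : ℂ) (7 / 8), .ofReal (exp (W z)) :=
          setLIntegral_mono' measurableSet_ball fun z hz => by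
            gcongr; exact hfW n z hz
      _ ≤ ∫⁻ z in ball (0 : ℂ) 1, .ofReal (exp (W z)) :=
          lintegral_mono_set (ball_subset_ball (by norm_num))
      _ ≤ _ := hInt

section subharmonic

variable {u : ℂ → ℝ} {D : ℝ}

theorem lowerSemicontinuous_indicator_sub (hu : UpperSemicontinuousOn u (ball 0 1))
    (hD : ∀ z ∈ ball (0 : ℂ) 1, u z ≤ D) :
    LowerSemicontinuous ((ball (0 : ℂ) 1).indicator fun z => D - u z) := by
  intro z b hb
  by_cases hz : z ∈ ball (0 : ℂ) 1
  · rw [indicator_of_mem hz] at hb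
    have hev := hu z hz (D - b) (by linarith)
    rw [isOpen_ball.nhdsWithin_eq hz] at hev
    filter_upwards [hev, isOpen_ball.mem_nhds hz] with y hy hyb
    rw [indicator_of_mem hyb]
    linarith
  · rw [indicator_of_notMem hz] at hb
    exact .of_forall fun y => hb.trans_le (indicator_nonneg (fun y hy => sub_nonneg.2 (hD y hy)) y)

theorem circleAverage_indicator_sub_le (hu : IsSubharmonicOn (ball 0 1) u) {a : ℂ} {r : ℝ}
    (hr : 0 < r) (har : ‖a‖ + r < 1)
    (hi : CircleIntegrable ((ball (0 : ℂ) 1).indicator fun z => D - u z) a r) :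
    circleAverage ((ball (0 : ℂ) 1).indicator fun z => D - u z) a r ≤
      (ball (0 : ℂ) 1).indicator (fun z => D - u z) a := by
  set V := (ball (0 : ℂ) 1).indicator fun z => D - u z with hV
  have hmem : ∀ z : ℂ, ‖z - a‖ ≤ r → z ∈ ball (0 : ℂ) 1 := fun z hz => by
    have := norm_sub_norm_le z a
    rw [mem_ball_zero_iff]
    linarith
  have ha : a ∈ ball (0 : ℂ) 1 := hmem a (by simpa using hr.le)
  have hsub := hu.2 a ha r hr hmem
  have e : circleAverage u a r = D - circleAverage V a r := by
    rw [circleAverage_congr_sphere (f₂ := fun z => D - V z),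
      circleAverage_fun_sub (circleIntegrable_const _ _ _) hi, circleAverage_const]
    intro z hz
    have : ‖z - a‖ ≤ r := by rw [← dist_eq_norm, mem_sphere.1 hz, abs_of_pos hr]
    simp only [hV, indicator_of_mem (hmem z this)]
    ring
  have e2 : V a = D - u a := indicator_of_mem ha _
  have e3 : u a ≤ circleAverage u a r := by
    simpa only [circleAverage_def, circleMap, smul_eq_mul] using hsub
  linarith

theorem lintegral_exp_sub_le_of_isSubharmonicOn {A ε : ℝ} (hu : IsSubharmonicOn (ball 0 1) u)
    (hD : ∀ z ∈ ball (0 : ℂ) 1, u z ≤ D) (hA : 1 ≤ A)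
    (hInt : ∫⁻ z in ball (0 : ℂ) 1, .ofReal (exp (D - u z)) ≤ .ofReal A) (hε : 0 ≤ ε)
    (hεA : ε * (128 * A) ≤ 1) :
    ∫⁻ z in ball (0 : ℂ) (1 / 2), .ofReal (exp ((1 + ε) * (D - u z))) ≤
      .ofReal (512000 * exp 10 * A) := by
  set V := (ball (0 : ℂ) 1).indicator fun z => D - u z with hV
  have hVball : ∀ z ∈ ball (0 : ℂ) 1, V z = D - u z := fun z hz => indicator_of_mem hz _
  have hV0 : ∀ z, 0 ≤ V z := indicator_nonneg fun z hz => sub_nonneg.2 (hD z hz)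
  have hlsc : LowerSemicontinuous V := lowerSemicontinuous_indicator_sub hu.1 hD
  have hVm := hlsc.measurable
  have hInt' : ∫⁻ z in ball (0 : ℂ) 1, .ofReal (exp (V z)) ≤ .ofReal A := by
    refine le_of_eq_of_le (setLIntegral_congr_fun measurableSet_ball fun z hz => ?_) hInt
    simp only [hVball z hz]
  have hVi : Integrable V := by
    have h1 : IntegrableOn (fun z => exp (V z)) (ball 0 1) := by
      refine (lintegral_ofReal_ne_top_iff_integrable
        (Measurable.aestronglyMeasurable (by fun_prop)) (.of_forall fun z => (exp_pos _).le)).1 ?_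
      exact (hInt'.trans_lt ENNReal.ofReal_lt_top).ne
    refine ((integrable_indicator_iff measurableSet_ball).2 h1).mono'
      hVm.aestronglyMeasurable (.of_forall fun z => ?_)
    rw [norm_of_nonneg (hV0 z)]
    by_cases hz : z ∈ ball (0 : ℂ) 1
    · rw [indicator_of_mem hz]; linarith [add_one_le_exp (V z)]
    · rw [indicator_of_notMem hz, hV, indicator_of_notMem hz]
  have htame : ∀ n : ℕ, IsTame fun z => min (V z) n := fun n => by
    refine IsTame.of_bounded_on_ball (c := 0) (t := 1) (B := n) (by fun_prop) (fun z _ => ?_)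
      fun z hz => ?_
    · rw [abs_of_nonneg (le_min (hV0 z) n.cast_nonneg)]
      exact min_le_right _ _
    · rw [hV, indicator_of_notMem hz]
      exact min_eq_left n.cast_nonneg
  have hsm : ∀ (n : ℕ) (a : ℂ), ∀ᵐ r ∂volume.restrict (Ioi (0 : ℝ)), ‖a‖ + r < 1 →
      circleAverage (fun z => min (V z) n) a r ≤ min (V a) n := by
    intro n a
    filter_upwards [ae_circleIntegrable hVi a, ae_circleIntegrable (htame n).integrable a,
      ae_restrict_mem measurableSet_Ioi] with r hr hr' hr0 har
    refine le_min ?_ ?_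
    · exact (circleAverage_mono hr' hr fun z _ => min_le_left _ _).trans
        (circleAverage_indicator_sub_le hu hr0 har hr)
    · exact circleAverage_mono_on_of_le_circle hr' fun z _ => min_le_right _ _
  have hfinal : ∫⁻ z in ball (0 : ℂ) (1 / 2), .ofReal (exp ((1 + ε) * V z)) ≤
      .ofReal (512000 * exp 10 * A) := by
    refine lintegral_exp_le_of_tendsto (U := fun (n : ℕ) z => min (V z) n) measurableSet_ball
      (fun n => (htame n).measurable) (fun z _ => ?_) fun n => ?_
    · refine tendsto_const_nhds.congr' ?_
      filter_upwards [Filter.eventually_ge_atTop ⌈V z⌉₊] with n hn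
      exact (min_eq_left (Nat.ceil_le.1 hn)).symm
    · refine lintegral_exp_le_of_superMean (htame n) (fun z => le_min (hV0 z) n.cast_nonneg)
        (hsm n) (fun z b hb => ?_) hA (le_trans (lintegral_mono fun z => ?_) hInt') hε hεA
      · have hb' := lt_min_iff.1 hb
        filter_upwards [hlsc z b hb'.1] with y hy using lt_min hy hb'.2
      · gcongr
        exact min_le_left _ _
  refine le_of_eq_of_le (setLIntegral_congr_fun measurableSet_ball fun z hz => ?_) hfinal
  simp only [hVball z (ball_subset_ball (by norm_num) hz)]

end subharmonic

end

/-- One-complex-dimensional case of the quantitative openness theorem (Theorem 2.2 of the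
paper): there are constants `δ > 0` and `C > 0` such that, for any `D ∈ ℝ`, `A ∈ (0, ∞)`
and any subharmonic `u` on the open unit disc `𝔻 ⊆ ℂ` with `u ≤ D` on `𝔻` and
`∫_𝔻 e^{-u} dλ < A`, setting `ε = δ/(e^D · A)` one has
`∫_{𝔻(0,1/2)} e^{-(1+ε)u} dλ < C · (e^{-εD} · A + e^{-(1+ε)D})`. -/
theorem berndtsson_openness_dim_one :
    ∃ δ C : ℝ, 0 < δ ∧ 0 < C ∧
      ∀ (D A : ℝ), 0 < A →
        ∀ u : ℂ → ℝ,
          IsSubharmonicOn (Metric.ball (0 : ℂ) 1) u →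
          (∀ z ∈ Metric.ball (0 : ℂ) 1, u z ≤ D) →
          (∫⁻ z in Metric.ball (0 : ℂ) 1, ENNReal.ofReal (Real.exp (-u z)))
              < ENNReal.ofReal A →
          ∀ ε : ℝ, ε = δ / (Real.exp D * A) →
            (∫⁻ z in Metric.ball (0 : ℂ) (1 / 2),
                ENNReal.ofReal (Real.exp (-(1 + ε) * u z)))
              < ENNReal.ofReal (C * (Real.exp (-ε * D) * A + Real.exp (-(1 + ε) * D))) := by
  refine ⟨1 / 128, 512000 * Real.exp 10, by norm_num, by positivity, ?_⟩
  rintro D A hA u hu hD hInt ε rfl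
  set ε := 1 / 128 / (Real.exp D * A) with hεdef
  have hε : 0 ≤ ε := by positivity
  have hεA : ε * (128 * (Real.exp D * A)) ≤ 1 := by
    rw [hεdef]; field_simp; norm_num
  have hInt' : ∫⁻ z in Metric.ball (0 : ℂ) 1, .ofReal (Real.exp (D - u z)) ≤
      .ofReal (Real.exp D * A) := by
    simp only [sub_eq_add_neg, Real.exp_add, ENNReal.ofReal_mul (Real.exp_pos D).le]
    rw [lintegral_const_mul' _ _ ENNReal.ofReal_ne_top]
    gcongr
  have hA1 : 1 ≤ Real.exp D * A := by
    rw [← ENNReal.ofReal_le_ofReal_iff (by positivity)]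
    refine le_trans ?_ hInt'
    calc ENNReal.ofReal 1 ≤ volume (Metric.ball (0 : ℂ) 1) := by
          rw [Complex.volume_ball]
          simpa [← NNReal.coe_le_coe] using by linarith [Real.pi_gt_three]
      _ = ∫⁻ z in Metric.ball (0 : ℂ) 1, 1 := by simp
      _ ≤ _ := setLIntegral_mono' measurableSet_ball fun z hz => by
          rw [← ENNReal.ofReal_one]
          exact ENNReal.ofReal_le_ofReal (Real.one_le_exp (sub_nonneg.2 (hD z hz)))
  have hmain := lintegral_exp_sub_le_of_isSubharmonicOn hu hD hA1 hInt' hε hεA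
  have e : ∀ z, ENNReal.ofReal (Real.exp (-(1 + ε) * u z)) =
      .ofReal (Real.exp (-(1 + ε) * D)) * .ofReal (Real.exp ((1 + ε) * (D - u z))) := fun z => by
    rw [← ENNReal.ofReal_mul (Real.exp_pos _).le, ← Real.exp_add]
    ring_nf
  simp only [e]
  rw [lintegral_const_mul' _ _ ENNReal.ofReal_ne_top]
  refine lt_of_le_of_lt (mul_le_mul_right hmain _) ?_
  rw [← ENNReal.ofReal_mul (Real.exp_pos _).le, ENNReal.ofReal_lt_ofReal_iff (by positivity)]
  have e2 : Real.exp (-(1 + ε) * D) * Real.exp D = Real.exp (-ε * D) := by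
    rw [← Real.exp_add]; ring_nf
  have h1 : Real.exp (-(1 + ε) * D) * (512000 * Real.exp 10 * (Real.exp D * A)) =
      512000 * Real.exp 10 * (Real.exp (-ε * D) * A) := by rw [← e2]; ring
  rw [h1]
  gcongr
  linarith [Real.exp_pos (-(1 + ε) * D)]
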